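/- arXiv:2412.02070 — 2 statements merged into one kernel-verified Lean document; each statement's English description precedes it below -/
import Mathlib

section
/- Let d ≥ 3 be an integer, p > 1 a real number, and ζ ∈ {0,1}. Let u : ℝ^d × ℝ → ℝ be twice continuously differentiable on (ℝ^d ∖ {0}) × ℝ. Then for every (x,t) with x ≠ 0 the following pointwise identity holds (all quantities evaluated at (x,t)): ∂ₜ[ ½(L₋u)² + e' ] + Σ_{j=1}^d ∂_{x_j}[ (L₋u)·(∇̸u)_j + (x_j/|x|)·(½(L₋u)² − e') ] = −Eq(u)·(L₋u) + 2M, where L₋u := (x/|x|)·∇ₓu + ((d−1)/2)·u/|x| − ∂ₜu, ∇̸u := ∇ₓu − ((x/|x|)·∇ₓu)·(x/|x|), λ := (d−1)(d−3)/4, e' := ½|∇̸u|² + (λ/2)·u²/|x|² + u²/(2|x|) + ζ·|u|^{p+1}/(p+1), M := ½·|∇̸u|²/|x| + (λ/2)·u²/|x|³ + ζ·(d−1)(p−1)·|u|^{p+1}/(4(p+1)|x|) + u²/(4|x|²), and Eq(u) := ∂ₜ²u − Δₓu + u/|x| + ζ·|u|^{p−1}u. -/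
open MeasureTheory

/-- The Laplacian of `u : ℝ^d → ℝ`, as the sum of second derivatives in the
coordinate directions. -/
noncomputable def lap {d : ℕ} (u : EuclideanSpace ℝ (Fin d) → ℝ)
    (x : EuclideanSpace ℝ (Fin d)) : ℝ :=
  ∑ i : Fin d, iteratedFDeriv ℝ 2 u x ![EuclideanSpace.single i 1, EuclideanSpace.single i 1]

/-- The radial derivative `u_r(x) = (x/|x|) · ∇u(x)`. -/
noncomputable def rderiv {d : ℕ} (u : EuclideanSpace ℝ (Fin d) → ℝ)
    (x : EuclideanSpace ℝ (Fin d)) : ℝ :=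
  @inner ℝ _ _ (‖x‖⁻¹ • x) (gradient u x)

/-- The angular part `∇̸u = ∇u - u_r · x/|x|` of the gradient. -/
noncomputable def angGrad {d : ℕ} (u : EuclideanSpace ℝ (Fin d) → ℝ)
    (x : EuclideanSpace ℝ (Fin d)) : EuclideanSpace ℝ (Fin d) :=
  gradient u x - rderiv u x • (‖x‖⁻¹ • x)

/-- `λ = (d-1)(d-3)/4`. -/
noncomputable def lam (d : ℕ) : ℝ := ((d : ℝ) - 1) * ((d : ℝ) - 3) / 4

/-- `L₋u = u_r + ((d-1)/2)·u/|x| - ∂ₜu`. -/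
noncomputable def Lminus {d : ℕ} (u : EuclideanSpace ℝ (Fin d) → ℝ → ℝ)
    (x : EuclideanSpace ℝ (Fin d)) (t : ℝ) : ℝ :=
  rderiv (fun y => u y t) x + ((d : ℝ) - 1) / 2 * u x t / ‖x‖ - deriv (u x) t

/-- The non-directional energy density
`e' = ½|∇̸u|² + (λ/2)u²/|x|² + u²/(2|x|) + ζ|u|^{p+1}/(p+1)`. -/
noncomputable def ePrime {d : ℕ} (p ζ : ℝ) (u : EuclideanSpace ℝ (Fin d) → ℝ → ℝ)
    (x : EuclideanSpace ℝ (Fin d)) (t : ℝ) : ℝ :=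
  (1 / 2) * ‖angGrad (fun y => u y t) x‖ ^ 2 + lam d / 2 * (u x t) ^ 2 / ‖x‖ ^ 2
    + (u x t) ^ 2 / (2 * ‖x‖) + ζ * |u x t| ^ (p + 1) / (p + 1)

/-- The Morawetz density
`M = ½|∇̸u|²/|x| + (λ/2)u²/|x|³ + ζ(d-1)(p-1)|u|^{p+1}/(4(p+1)|x|) + u²/(4|x|²)`. -/
noncomputable def Mden {d : ℕ} (p ζ : ℝ) (u : EuclideanSpace ℝ (Fin d) → ℝ → ℝ)
    (x : EuclideanSpace ℝ (Fin d)) (t : ℝ) : ℝ :=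
  (1 / 2) * ‖angGrad (fun y => u y t) x‖ ^ 2 / ‖x‖ + lam d / 2 * (u x t) ^ 2 / ‖x‖ ^ 3
    + ζ * ((d : ℝ) - 1) * (p - 1) * |u x t| ^ (p + 1) / (4 * (p + 1) * ‖x‖)
    + (u x t) ^ 2 / (4 * ‖x‖ ^ 2)

/-- `Eq(u) = ∂ₜ²u - Δu + u/|x| + ζ|u|^{p-1}u`. -/
noncomputable def EqOp {d : ℕ} (p ζ : ℝ) (u : EuclideanSpace ℝ (Fin d) → ℝ → ℝ)
    (x : EuclideanSpace ℝ (Fin d)) (t : ℝ) : ℝ :=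
  deriv (deriv (u x)) t - lap (fun y => u y t) x + u x t / ‖x‖
    + ζ * |u x t| ^ (p - 1) * u x t

/-- The spatial flux vector field
`F = (L₋u)·∇̸u + (½(L₋u)² - e')·x/|x|` of the outward energy identity. -/
noncomputable def Fvec {d : ℕ} (p ζ : ℝ) (u : EuclideanSpace ℝ (Fin d) → ℝ → ℝ)
    (x : EuclideanSpace ℝ (Fin d)) (t : ℝ) : EuclideanSpace ℝ (Fin d) :=
  Lminus u x t • angGrad (fun y => u y t) x
    + ((1 / 2) * (Lminus u x t) ^ 2 - ePrime p ζ u x t) • (‖x‖⁻¹ • x)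

/-- The derivative of `y ↦ ‖y‖⁻¹` away from the origin. -/
lemma hasFDerivAt_inv_norm {E : Type*} [NormedAddCommGroup E] [InnerProductSpace ℝ E] {x : E}
    (hx : x ≠ 0) :
    HasFDerivAt (fun y : E => ‖y‖⁻¹) (-(‖x‖⁻¹ ^ 3) • innerSL ℝ x) x := by
  have hr : ‖x‖ ≠ 0 := norm_ne_zero_iff.mpr hx
  have h1 : HasFDerivAt (fun y : E => √(‖y‖ ^ 2)) _ x :=
    ((hasStrictFDerivAt_norm_sq x).hasFDerivAt).sqrt (pow_ne_zero 2 hr)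
  simp only [Real.sqrt_sq (norm_nonneg _)] at h1
  have h2 := (hasDerivAt_inv hr).comp_hasFDerivAt x h1
  refine h2.congr_fderiv ?_
  ext h
  simp
  field_simp

/-- The derivative of the radial unit vector field `y ↦ y/|y|`. -/
lemma hasFDerivAt_inv_norm_smul {E : Type*} [NormedAddCommGroup E] [InnerProductSpace ℝ E]
    {x : E} (hx : x ≠ 0) :
    HasFDerivAt (fun y : E => ‖y‖⁻¹ • y)
      (‖x‖⁻¹ • (ContinuousLinearMap.id ℝ E - (innerSL ℝ (‖x‖⁻¹ • x)).smulRight (‖x‖⁻¹ • x))) x := by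
  refine ((hasFDerivAt_inv_norm hx).smul (hasFDerivAt_id x)).congr_fderiv ?_
  ext h
  simp [smul_smul, smul_sub]
  module

lemma inner_unit_self {E : Type*} [NormedAddCommGroup E] [InnerProductSpace ℝ E] {x : E}
    (hx : x ≠ 0) : inner ℝ (‖x‖⁻¹ • x) (‖x‖⁻¹ • x) = 1 := by
  rw [real_inner_self_eq_norm_sq, norm_smul, norm_inv, norm_norm,
    inv_mul_cancel₀ (norm_ne_zero_iff.mpr hx), one_pow]

lemma sum_fderiv_apply_single {d : ℕ}
    {V : EuclideanSpace ℝ (Fin d) → EuclideanSpace ℝ (Fin d)} {x : EuclideanSpace ℝ (Fin d)}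
    {V' : EuclideanSpace ℝ (Fin d) →L[ℝ] EuclideanSpace ℝ (Fin d)} (hV : HasFDerivAt V V' x) :
    ∑ j : Fin d, fderiv ℝ (fun y => V y j) x (EuclideanSpace.single j 1)
      = ∑ j : Fin d, V' (EuclideanSpace.single j 1) j := by
  refine Finset.sum_congr rfl fun j _ => ?_
  have h := (EuclideanSpace.proj (𝕜 := ℝ) (ι := Fin d) j).hasFDerivAt.comp x hV
  have h' : HasFDerivAt (fun y => V y j) _ x := h
  rw [h'.fderiv]
  rfl

lemma sum_apply_single_mul {d : ℕ} (φ : EuclideanSpace ℝ (Fin d) →L[ℝ] ℝ)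
    (w : EuclideanSpace ℝ (Fin d)) :
    ∑ j : Fin d, φ (EuclideanSpace.single j 1) * w j = φ w := by
  conv_rhs => rw [← (EuclideanSpace.basisFun (Fin d) ℝ).sum_repr w]
  simp [mul_comm]

lemma sum_fderiv_unit_apply_single {d : ℕ} {x : EuclideanSpace ℝ (Fin d)} (hx : x ≠ 0) :
    ∑ j : Fin d, (‖x‖⁻¹ • (ContinuousLinearMap.id ℝ (EuclideanSpace ℝ (Fin d))
        - (innerSL ℝ (‖x‖⁻¹ • x)).smulRight (‖x‖⁻¹ • x))) (EuclideanSpace.single j 1) j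
      = ‖x‖⁻¹ * ((d : ℝ) - 1) := by
  have h := sum_apply_single_mul (innerSL ℝ (‖x‖⁻¹ • x)) (‖x‖⁻¹ • x)
  rw [innerSL_apply_apply, inner_unit_self hx] at h
  simp only [smul_apply, sub_apply, ContinuousLinearMap.id_apply,
    ContinuousLinearMap.smulRight_apply, PiLp.sub_apply, PiLp.smul_apply, smul_eq_mul,
    ← Finset.mul_sum, Finset.sum_sub_distrib] at h ⊢
  congr 2
  simp

section Derivatives

variable {d : ℕ} {f : EuclideanSpace ℝ (Fin d) → ℝ} {x : EuclideanSpace ℝ (Fin d)}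
  {u : EuclideanSpace ℝ (Fin d) → ℝ → ℝ} {t p ζ : ℝ} {b : EuclideanSpace ℝ (Fin d)}
  {A : EuclideanSpace ℝ (Fin d) →L[ℝ] EuclideanSpace ℝ (Fin d)}

lemma inner_unit_angGrad (hx : x ≠ 0) : inner ℝ (‖x‖⁻¹ • x) (angGrad f x) = 0 := by
  rw [angGrad, inner_sub_right, inner_smul_right _ _ (rderiv f x), inner_unit_self hx, rderiv]
  ring

lemma inner_gradient_angGrad (hx : x ≠ 0) :
    inner ℝ (gradient f x) (angGrad f x) = ‖angGrad f x‖ ^ 2 := by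
  have h : gradient f x = angGrad f x + rderiv f x • (‖x‖⁻¹ • x) := by simp [angGrad]
  conv_lhs => rw [h]
  rw [inner_add_left, real_inner_smul_left, inner_unit_angGrad hx, real_inner_self_eq_norm_sq]
  ring

lemma exists_hasFDerivAt_rderiv (hx : x ≠ 0) (hA : HasFDerivAt (gradient f) A x) :
    ∃ R : EuclideanSpace ℝ (Fin d) →L[ℝ] ℝ, HasFDerivAt (rderiv f) R x ∧
      ∀ h, R h = ‖x‖⁻¹ * inner ℝ (angGrad f x) h + inner ℝ (‖x‖⁻¹ • x) (A h) := by
  refine ⟨_, (hasFDerivAt_inv_norm_smul hx).inner ℝ hA, fun h => ?_⟩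
  simp only [angGrad, rderiv, ContinuousLinearMap.comp_apply, ContinuousLinearMap.prod_apply,
    fderivInnerCLM_apply, smul_apply, sub_apply,
    ContinuousLinearMap.id_apply, ContinuousLinearMap.smulRight_apply, innerSL_apply_apply,
    inner_sub_left, real_inner_smul_left]
  rw [real_inner_comm h (gradient f x)]
  ring

lemma exists_hasFDerivAt_angGrad (hx : x ≠ 0) (hA : HasFDerivAt (gradient f) A x) :
    ∃ N : EuclideanSpace ℝ (Fin d) →L[ℝ] EuclideanSpace ℝ (Fin d),
      HasFDerivAt (angGrad f) N x ∧
      N (‖x‖⁻¹ • x) = A (‖x‖⁻¹ • x)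
        - inner ℝ (‖x‖⁻¹ • x) (A (‖x‖⁻¹ • x)) • (‖x‖⁻¹ • x) ∧
      ∑ j : Fin d, N (EuclideanSpace.single j 1) j
        = ∑ j : Fin d, A (EuclideanSpace.single j 1) j
          - inner ℝ (‖x‖⁻¹ • x) (A (‖x‖⁻¹ • x)) - rderiv f x * (‖x‖⁻¹ * ((d : ℝ) - 1)) := by
  obtain ⟨R, hR, hR'⟩ := exists_hasFDerivAt_rderiv hx hA
  have hRx : R (‖x‖⁻¹ • x) = inner ℝ (‖x‖⁻¹ • x) (A (‖x‖⁻¹ • x)) := by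
    rw [hR', real_inner_comm, inner_unit_angGrad hx, mul_zero, zero_add]
  refine ⟨_, hA.sub (hR.smul (hasFDerivAt_inv_norm_smul hx)), ?_, ?_⟩
  · simp only [smul_apply, sub_apply, add_apply, ContinuousLinearMap.id_apply,
      ContinuousLinearMap.smulRight_apply, innerSL_apply_apply, hRx, inner_unit_self hx]
    module
  · rw [← sum_fderiv_unit_apply_single hx, ← hRx, ← sum_apply_single_mul R]
    simp only [sub_apply, add_apply, ContinuousLinearMap.smulRight_apply,
      PiLp.sub_apply, PiLp.add_apply, PiLp.smul_apply, smul_eq_mul, Finset.mul_sum,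
      ← Finset.sum_sub_distrib]
    refine Finset.sum_congr rfl fun j _ => ?_
    simp
    ring

lemma exists_hasFDerivAt_Lminus (hx : x ≠ 0)
    (hu : HasFDerivAt (fun y => u y t) (innerSL ℝ (gradient (fun y => u y t) x)) x)
    (hA : HasFDerivAt (gradient fun y => u y t) A x)
    (hb : HasFDerivAt (fun y => deriv (u y) t) (innerSL ℝ b) x) :
    ∃ L : EuclideanSpace ℝ (Fin d) →L[ℝ] ℝ, HasFDerivAt (fun y => Lminus u y t) L x ∧
      ∀ h, L h = ‖x‖⁻¹ * inner ℝ (angGrad (fun y => u y t) x) h + inner ℝ (‖x‖⁻¹ • x) (A h)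
        + ((d : ℝ) - 1) / 2 * (inner ℝ (gradient (fun y => u y t) x) h * ‖x‖⁻¹
          - u x t * ‖x‖⁻¹ ^ 2 * inner ℝ (‖x‖⁻¹ • x) h) - inner ℝ b h := by
  obtain ⟨R, hR, hR'⟩ := exists_hasFDerivAt_rderiv hx hA
  have h1 := (hR.add ((hu.const_mul (((d : ℝ) - 1) / 2)).mul (hasFDerivAt_inv_norm hx))).sub hb
  refine ⟨_, h1, fun h => ?_⟩
  simp only [smul_apply, sub_apply, add_apply, innerSL_apply_apply, hR', real_inner_smul_left,
    smul_eq_mul]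
  ring

lemma hasDerivAt_Lminus (hut : HasDerivAt (u x) (deriv (u x) t) t)
    (hb : HasDerivAt (fun s => gradient (fun y => u y s) x) b t)
    (htt : HasDerivAt (deriv (u x)) (deriv (deriv (u x)) t) t) :
    HasDerivAt (fun s => Lminus u x s)
      (inner ℝ (‖x‖⁻¹ • x) b + ((d : ℝ) - 1) / 2 * deriv (u x) t * ‖x‖⁻¹
        - deriv (deriv (u x)) t) t := by
  have h1 := (((hasDerivAt_const t (‖x‖⁻¹ • x)).inner ℝ hb).add
    ((hut.const_mul (((d : ℝ) - 1) / 2)).mul_const ‖x‖⁻¹)).sub htt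
  refine HasDerivAt.congr_deriv h1 ?_
  simp

lemma hasDerivAt_angGrad (hb : HasDerivAt (fun s => gradient (fun y => u y s) x) b t) :
    HasDerivAt (fun s => angGrad (fun y => u y s) x)
      (b - inner ℝ (‖x‖⁻¹ • x) b • (‖x‖⁻¹ • x)) t := by
  have h1 := hb.sub (((hasDerivAt_const t (‖x‖⁻¹ • x)).inner ℝ hb).smul_const (‖x‖⁻¹ • x))
  refine HasDerivAt.congr_deriv h1 ?_
  simp

lemma hasDerivAt_ePrime (hx : x ≠ 0) (hp : 1 < p)
    (hut : HasDerivAt (u x) (deriv (u x) t) t)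
    (hb : HasDerivAt (fun s => gradient (fun y => u y s) x) b t) :
    HasDerivAt (fun s => ePrime p ζ u x s)
      (inner ℝ (angGrad (fun y => u y t) x) b
        + (lam d * u x t * ‖x‖⁻¹ ^ 2 + u x t * ‖x‖⁻¹ + ζ * |u x t| ^ (p - 1) * u x t)
          * deriv (u x) t) t := by
  have h1 := ((((hasDerivAt_angGrad hb).norm_sq.const_mul (1 / 2)).add
    (((hut.pow 2).const_mul (lam d / 2)).div_const (‖x‖ ^ 2))).add
    ((hut.pow 2).div_const (2 * ‖x‖))).add
    ((((hasDerivAt_abs_rpow (u x t) (by linarith : 1 < p + 1)).comp t hut).const_mul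
      ζ).div_const (p + 1))
  refine HasDerivAt.congr_deriv h1 ?_
  rw [inner_sub_right, inner_smul_right _ _ (inner ℝ _ b),
    real_inner_comm (‖x‖⁻¹ • x) (angGrad _ x), inner_unit_angGrad hx,
    show p + 1 - 2 = p - 1 by ring]
  have hp1 : p + 1 ≠ 0 := by linarith
  have hr : ‖x‖ ≠ 0 := norm_ne_zero_iff.mpr hx
  field_simp
  ring

lemma exists_hasFDerivAt_ePrime (hx : x ≠ 0) (hp : 1 < p)
    (hu : HasFDerivAt (fun y => u y t) (innerSL ℝ (gradient (fun y => u y t) x)) x)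
    (hA : HasFDerivAt (gradient fun y => u y t) A x) :
    ∃ e : EuclideanSpace ℝ (Fin d) →L[ℝ] ℝ, HasFDerivAt (fun y => ePrime p ζ u y t) e x ∧
      e (‖x‖⁻¹ • x) = inner ℝ (angGrad (fun y => u y t) x) (A (‖x‖⁻¹ • x))
        + (lam d * u x t * ‖x‖⁻¹ ^ 2 + u x t * ‖x‖⁻¹ + ζ * |u x t| ^ (p - 1) * u x t)
          * rderiv (fun y => u y t) x
        - lam d * u x t ^ 2 * ‖x‖⁻¹ ^ 3 - u x t ^ 2 * ‖x‖⁻¹ ^ 2 / 2 := by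
  obtain ⟨N, hN, hNx, -⟩ := exists_hasFDerivAt_angGrad hx hA
  have hq := hasFDerivAt_inv_norm hx
  have h1 := (((hN.norm_sq.const_mul (1 / 2)).add
    (((hu.pow 2).const_mul (lam d / 2)).mul (hq.pow 2))).add
    (((hu.pow 2).mul hq).const_mul (1 / 2))).add
    (((hasDerivAt_abs_rpow (u x t) (by linarith : 1 < p + 1)).comp_hasFDerivAt x hu).const_mul
      (ζ / (p + 1)))
  refine ⟨_, h1.congr_of_eventuallyEq (Filter.Eventually.of_forall fun y => ?_), ?_⟩
  · simp only [ePrime, Pi.add_apply, Function.comp_apply, Pi.mul_apply, div_eq_mul_inv,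
      mul_inv, inv_pow]
    ring
  · have hxx : inner ℝ x (‖x‖⁻¹ • x) = ‖x‖ := by
      rw [real_inner_smul_right, real_inner_self_eq_norm_sq]
      field_simp
    have hg : inner ℝ (gradient (fun y => u y t) x) (‖x‖⁻¹ • x) = rderiv (fun y => u y t) x :=
      real_inner_comm _ _
    have hNN : inner ℝ (angGrad (fun y => u y t) x) (N (‖x‖⁻¹ • x))
        = inner ℝ (angGrad (fun y => u y t) x) (A (‖x‖⁻¹ • x)) := by
      rw [hNx, inner_sub_right, inner_smul_right _ _ (inner ℝ _ (A _)),
        real_inner_comm (‖x‖⁻¹ • x) (angGrad _ x), inner_unit_angGrad hx]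
      ring
    simp only [smul_apply, add_apply, innerSL_apply_apply, smul_eq_mul,
      ContinuousLinearMap.comp_apply, hNN, hxx, hg, show p + 1 - 2 = p - 1 by ring]
    have hp1 : p + 1 ≠ 0 := by linarith
    have hr : ‖x‖ ≠ 0 := norm_ne_zero_iff.mpr hx
    simp
    field_simp
    ring

lemma sum_fderiv_Fvec (hx : x ≠ 0) {L e : EuclideanSpace ℝ (Fin d) →L[ℝ] ℝ}
    (hA : HasFDerivAt (gradient fun y => u y t) A x)
    (hL : HasFDerivAt (fun y => Lminus u y t) L x)
    (he : HasFDerivAt (fun y => ePrime p ζ u y t) e x) :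
    ∑ j : Fin d, fderiv ℝ (fun y => Fvec p ζ u y t j) x (EuclideanSpace.single j 1)
      = Lminus u x t * (∑ j : Fin d, A (EuclideanSpace.single j 1) j
          - inner ℝ (‖x‖⁻¹ • x) (A (‖x‖⁻¹ • x))
          - rderiv (fun y => u y t) x * (‖x‖⁻¹ * ((d : ℝ) - 1)))
        + L (angGrad (fun y => u y t) x)
        + (1 / 2 * Lminus u x t ^ 2 - ePrime p ζ u x t) * (‖x‖⁻¹ * ((d : ℝ) - 1))
        + (Lminus u x t * L (‖x‖⁻¹ • x) - e (‖x‖⁻¹ • x)) := by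
  obtain ⟨N, hN, -, hNtr⟩ := exists_hasFDerivAt_angGrad hx hA
  have hV := (hL.smul hN).add
    ((((hL.pow 2).const_mul (1 / 2)).sub he).smul (hasFDerivAt_inv_norm_smul hx))
  rw [sum_fderiv_apply_single (V := fun y => Fvec p ζ u y t) hV, ← hNtr, ← sum_fderiv_unit_apply_single hx,
    ← sum_apply_single_mul L, ← sum_apply_single_mul L, ← sum_apply_single_mul e]
  simp only [Finset.mul_sum, ← Finset.sum_sub_distrib, ← Finset.sum_add_distrib]
  refine Finset.sum_congr rfl fun j _ => ?_
  simp
  ring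

end Derivatives

/-- The first and second order partial derivatives of a `C²` function of space and time. -/
lemma exists_second_derivatives {d : ℕ} {u : EuclideanSpace ℝ (Fin d) → ℝ → ℝ}
    {x : EuclideanSpace ℝ (Fin d)} {t : ℝ}
    (hu : ContDiffAt ℝ 2 (fun q : EuclideanSpace ℝ (Fin d) × ℝ => u q.1 q.2) (x, t)) :
    ∃ (A : EuclideanSpace ℝ (Fin d) →L[ℝ] EuclideanSpace ℝ (Fin d))
      (b : EuclideanSpace ℝ (Fin d)),
      HasFDerivAt (fun y => u y t) (innerSL ℝ (gradient (fun y => u y t) x)) x ∧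
      HasDerivAt (u x) (deriv (u x) t) t ∧
      HasFDerivAt (gradient fun y => u y t) A x ∧
      HasDerivAt (fun s => gradient (fun y => u y s) x) b t ∧
      HasFDerivAt (fun y => deriv (u y) t) (innerSL ℝ b) x ∧
      HasDerivAt (deriv (u x)) (deriv (deriv (u x)) t) t ∧
      (∀ h k, inner ℝ (A h) k = inner ℝ h (A k)) ∧
      lap (fun y => u y t) x = ∑ j : Fin d, A (EuclideanSpace.single j 1) j := by
  set U : EuclideanSpace ℝ (Fin d) × ℝ → ℝ := fun q => u q.1 q.2 with hU
  have hdiff : ∀ᶠ q in nhds (x, t), DifferentiableAt ℝ U q :=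
    (hu.eventually (by simp)).mono fun q hq => hq.differentiableAt (by norm_num)
  have hH : HasFDerivAt (fderiv ℝ U) (fderiv ℝ (fderiv ℝ U) (x, t)) (x, t) :=
    ((hu.fderiv_right (m := 1) (by norm_num)).differentiableAt (by norm_num)).hasFDerivAt
  set H := fderiv ℝ (fderiv ℝ U) (x, t)
  have hsymm : ∀ v w, H v w = H w v := fun v w => (hu.isSymmSndFDerivAt (by simp)) v w
  have hinl : ∀ y s, HasFDerivAt (fun y : EuclideanSpace ℝ (Fin d) => (y, s))
      (ContinuousLinearMap.inl ℝ _ ℝ) y := fun y s => hasFDerivAt_prodMk_left y s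
  have hinr : ∀ y s, HasDerivAt (fun s : ℝ => (y, s))
      ((0, 1) : EuclideanSpace ℝ (Fin d) × ℝ) s := fun y s =>
    (hasDerivAt_const s y).prodMk (hasDerivAt_id s)
  have hspace : ∀ q : EuclideanSpace ℝ (Fin d) × ℝ, DifferentiableAt ℝ U q →
      HasFDerivAt (fun y => u y q.2) ((fderiv ℝ U q).comp (ContinuousLinearMap.inl ℝ _ ℝ)) q.1 :=
    fun q hq => HasFDerivAt.comp (g := U) q.1 hq.hasFDerivAt (hinl q.1 q.2)
  have htime : ∀ q : EuclideanSpace ℝ (Fin d) × ℝ, DifferentiableAt ℝ U q →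
      HasDerivAt (u q.1) (fderiv ℝ U q (0, 1)) q.2 :=
    fun q hq => HasFDerivAt.comp_hasDerivAt (l := U) q.2 hq.hasFDerivAt (hinr q.1 q.2)
  have hx0 : ∀ᶠ y in nhds x, DifferentiableAt ℝ U (y, t) :=
    (hinl x t).continuousAt.eventually hdiff
  have ht0 : ∀ᶠ s in nhds t, DifferentiableAt ℝ U (x, s) :=
    (hinr x t).continuousAt.eventually hdiff
  let S : (EuclideanSpace ℝ (Fin d) × ℝ →L[ℝ] ℝ) →L[ℝ] EuclideanSpace ℝ (Fin d) :=
    ContinuousLinearMap.comp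
      { toFun := (InnerProductSpace.toDual ℝ (EuclideanSpace ℝ (Fin d))).symm
        map_add' := map_add _
        map_smul' := by simp
        cont := (InnerProductSpace.toDual ℝ (EuclideanSpace ℝ (Fin d))).symm.continuous }
      ((ContinuousLinearMap.compL ℝ _ _ ℝ).flip (ContinuousLinearMap.inl ℝ _ ℝ))
  have hS : ∀ φ h, inner ℝ (S φ) h = φ (h, 0) := fun φ h => by
    simp [S, InnerProductSpace.toDual_symm_apply]
  have hgrad : ∀ q : EuclideanSpace ℝ (Fin d) × ℝ, DifferentiableAt ℝ U q →
      gradient (fun y => u y q.2) q.1 = S (fderiv ℝ U q) := fun q hq => by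
    rw [gradient, (hspace q hq).fderiv]
    rfl
  have hgx : HasFDerivAt (gradient fun y => u y t)
      (S.comp (H.comp (ContinuousLinearMap.inl ℝ _ ℝ))) x :=
    (S.hasFDerivAt.comp x
      (HasFDerivAt.comp (g := fderiv ℝ U) x hH (hinl x t))).congr_of_eventuallyEq
      (hx0.mono fun y hy => hgrad (y, t) hy)
  have htt : HasDerivAt (deriv (u x)) (H (0, 1) (0, 1)) t :=
    ((HasFDerivAt.comp_hasDerivAt (l := fderiv ℝ U) t hH (hinr x t)).clm_apply
      (hasDerivAt_const t ((0, 1) : EuclideanSpace ℝ (Fin d) × ℝ))).congr_of_eventuallyEq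
      (ht0.mono fun s hs => (htime (x, s) hs).deriv) |>.congr_deriv (by simp)
  refine ⟨S.comp (H.comp (ContinuousLinearMap.inl ℝ _ ℝ)), S (H (0, 1)), ?_,
    (htime _ hdiff.self_of_nhds).differentiableAt.hasDerivAt, hgx, ?_, ?_,
    htt.differentiableAt.hasDerivAt, ?_, ?_⟩
  · refine (hspace _ hdiff.self_of_nhds).congr_fderiv ?_
    ext h
    rw [hgrad (x, t) hdiff.self_of_nhds]
    simp [hS]
  · exact (S.hasFDerivAt.comp_hasDerivAt t
      (HasFDerivAt.comp_hasDerivAt (l := fderiv ℝ U) t hH (hinr x t))).congr_of_eventuallyEq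
      (ht0.mono fun s hs => hgrad (x, s) hs)
  · refine (((HasFDerivAt.comp (g := fderiv ℝ U) x hH (hinl x t)).clm_apply
      (hasFDerivAt_const ((0, 1) : EuclideanSpace ℝ (Fin d) × ℝ) x)).congr_of_eventuallyEq
      (hx0.mono fun y hy => (htime (y, t) hy).deriv)).congr_fderiv ?_
    ext h
    simp [hS, hsymm (0, 1)]
  · exact fun h k => (hS _ _).trans
      ((hsymm _ _).trans ((hS _ _).symm.trans (real_inner_comm _ _)))
  · have hff : HasFDerivAt (fderiv ℝ fun y => u y t)
        (((ContinuousLinearMap.compL ℝ _ _ ℝ).flip (ContinuousLinearMap.inl ℝ _ ℝ)).comp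
          (H.comp (ContinuousLinearMap.inl ℝ _ ℝ))) x :=
      ((ContinuousLinearMap.hasFDerivAt _).comp x
        (HasFDerivAt.comp (g := fderiv ℝ U) x hH (hinl x t))).congr_of_eventuallyEq
        (hx0.mono fun y hy => (hspace (y, t) hy).fderiv)
    refine Finset.sum_congr rfl fun j _ => ?_
    rw [iteratedFDeriv_two_apply, hff.fderiv]
    have h := hS (H (EuclideanSpace.single j 1, 0)) (EuclideanSpace.single j 1)
    rw [EuclideanSpace.inner_single_right] at h
    simpa using h.symm

/-- Pointwise divergence identity underlying the outward
energy flux: for `u` twice continuously differentiable on `(ℝ^d∖{0}) × ℝ`, at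
every `(x,t)` with `x ≠ 0`,
`∂ₜ[½(L₋u)² + e'] + div F = -Eq(u)·L₋u + 2M`. -/
theorem stmt12 (d : ℕ) (hd : 3 ≤ d) (p : ℝ) (hp : 1 < p) (ζ : ℝ)
    (hζ : ζ = 0 ∨ ζ = 1)
    (u : EuclideanSpace ℝ (Fin d) → ℝ → ℝ)
    (hreg : ContDiffOn ℝ 2 (fun q : EuclideanSpace ℝ (Fin d) × ℝ => u q.1 q.2)
      ({(0 : EuclideanSpace ℝ (Fin d))}ᶜ ×ˢ Set.univ)) :
    ∀ x : EuclideanSpace ℝ (Fin d), x ≠ 0 → ∀ t : ℝ,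
      deriv (fun s => (1 / 2) * (Lminus u x s) ^ 2 + ePrime p ζ u x s) t
        + ∑ j : Fin d,
            fderiv ℝ (fun y => Fvec p ζ u y t j) x (EuclideanSpace.single j 1)
      = -(EqOp p ζ u x t) * Lminus u x t + 2 * Mden p ζ u x t := by
  intro x hx t
  have hu2 : ContDiffAt ℝ 2 (fun q : EuclideanSpace ℝ (Fin d) × ℝ => u q.1 q.2) (x, t) :=
    hreg.contDiffAt ((isOpen_compl_singleton.prod isOpen_univ).mem_nhds ⟨hx, trivial⟩)
  obtain ⟨A, b, hu, hut, hA, hbt, hbx, htt, hsymm, hlap⟩ := exists_second_derivatives hu2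
  obtain ⟨L, hL, hL'⟩ := exists_hasFDerivAt_Lminus hx hu hA hbx
  obtain ⟨e, he, he'⟩ := exists_hasFDerivAt_ePrime (ζ := ζ) hx hp hu hA
  have hW : HasDerivAt (fun s => (1 / 2) * (Lminus u x s) ^ 2 + ePrime p ζ u x s) _ t :=
    (((hasDerivAt_Lminus hut hbt htt).pow 2).const_mul (1 / 2)).add
      (hasDerivAt_ePrime (ζ := ζ) hx hp hut hbt)
  have hg : inner ℝ (gradient (fun y => u y t) x) (‖x‖⁻¹ • x) = rderiv (fun y => u y t) x :=
    real_inner_comm _ _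
  rw [sum_fderiv_Fvec hx hA hL he,
    hW.deriv,
    hL', hL', he', EqOp, hlap, ← hsymm (‖x‖⁻¹ • x) (angGrad _ x),
    real_inner_comm (‖x‖⁻¹ • x) (angGrad _ x), inner_unit_angGrad hx,
    real_inner_self_eq_norm_sq (angGrad _ x), inner_gradient_angGrad hx, inner_unit_self hx,
    real_inner_comm (angGrad _ x) (A _), real_inner_comm (angGrad _ x) b,
    real_inner_comm (‖x‖⁻¹ • x) b, hg]
  have hpow : |u x t| ^ (p + 1) = |u x t| ^ (p - 1) * u x t ^ 2 := by
    rw [show p + 1 = p - 1 + (2 : ℕ) by push_cast; ring,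
      Real.rpow_add_natCast' (abs_nonneg _) (by push_cast; linarith), sq_abs]
  have hT : deriv (u x) t = rderiv (fun y => u y t) x + ((d : ℝ) - 1) / 2 * u x t * ‖x‖⁻¹
      - Lminus u x t := by
    rw [Lminus]
    ring
  have hp1 : p + 1 ≠ 0 := by linarith
  have hr : ‖x‖ ≠ 0 := norm_ne_zero_iff.mpr hx
  rw [ePrime, Mden, hpow, hT, lam]
  simp only [Nat.cast_ofNat, Nat.add_one_sub_one, pow_one]
  generalize Lminus u x t = l
  generalize |u x t| ^ (p - 1) = w
  field_simp
  ring
end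

section
/- Let d ≥ 4 be an integer, ζ ∈ {0,1}, and if ζ = 1 assume 4 ≤ d ≤ 5 and 1 + 4/(d−1) ≤ p ≤ 1 + 4/(d−2) (if ζ = 0 take p = 3, say; the p-terms then vanish). Let u be a classical finite-energy solution of the Coulomb wave equation ∂ₜ²u − Δₓu + u/|x| + ζ|u|^{p−1}u = 0 on ℝ^d with conserved energy E. Then the global Morawetz estimate ∫_ℝ ∫_{ℝ^d} M(x,t) dx dt ≤ E holds, where M(x,t) := ½·|∇̸u|²/|x| + (λ/2)·|u|²/|x|³ + ζ·(d−1)(p−1)·|u|^{p+1}/(4(p+1)|x|) + |u|²/(4|x|²), λ := (d−1)(d−3)/4, and ∇̸u := ∇ₓu − ((x/|x|)·∇ₓu)·(x/|x|). -/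
open MeasureTheory Filter

/-- The energy density
`e = ½|∇ₓu|² + ½|∂ₜu|² + u²/(2|x|) + ζ|u|^{p+1}/(p+1)` of the Coulomb wave
equation `∂ₜ²u - Δu + u/|x| + ζ|u|^{p-1}u = 0`. -/
noncomputable def eDen {d : ℕ} (p ζ : ℝ) (u : EuclideanSpace ℝ (Fin d) → ℝ → ℝ)
    (x : EuclideanSpace ℝ (Fin d)) (t : ℝ) : ℝ :=
  (1 / 2) * ‖gradient (fun y => u y t) x‖ ^ 2 + (1 / 2) * (deriv (u x) t) ^ 2
    + (u x t) ^ 2 / (2 * ‖x‖) + ζ * |u x t| ^ (p + 1) / (p + 1)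

/-- `u` is a classical finite-energy solution of the Coulomb wave equation
`∂ₜ²u - Δu + u/|x| + ζ|u|^{p-1}u = 0` with conserved energy `E`: it is
continuous on `ℝ^d × ℝ`, `C²` on `(ℝ^d∖{0}) × ℝ`, solves the equation away
from `x = 0`, and its total energy equals `E` at every time. -/
def IsCoulombSolution {d : ℕ} (p ζ : ℝ)
    (u : EuclideanSpace ℝ (Fin d) → ℝ → ℝ) (E : ℝ) : Prop :=
  Continuous (fun q : EuclideanSpace ℝ (Fin d) × ℝ => u q.1 q.2) ∧
  ContDiffOn ℝ 2 (fun q : EuclideanSpace ℝ (Fin d) × ℝ => u q.1 q.2)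
    ({(0 : EuclideanSpace ℝ (Fin d))}ᶜ ×ˢ Set.univ) ∧
  (∀ x : EuclideanSpace ℝ (Fin d), x ≠ 0 → ∀ t : ℝ,
    deriv (deriv (u x)) t - lap (fun y => u y t) x + u x t / ‖x‖
      + ζ * |u x t| ^ (p - 1) * u x t = 0) ∧
  (∀ t : ℝ, Integrable (fun x => eDen p ζ u x t)) ∧
  (∀ t : ℝ, ∫ x, eDen p ζ u x t = E)

/-- `L₊u = u_r + ((d-1)/2)·u/|x| + ∂ₜu`. -/
noncomputable def Lplus {d : ℕ} (u : EuclideanSpace ℝ (Fin d) → ℝ → ℝ)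
    (x : EuclideanSpace ℝ (Fin d)) (t : ℝ) : ℝ :=
  rderiv (fun y => u y t) x + ((d : ℝ) - 1) / 2 * u x t / ‖x‖ + deriv (u x) t

/-- The inward energy density `e₋ = ¼|L₊u|² + ½e'`. -/
noncomputable def eMinus {d : ℕ} (p ζ : ℝ) (u : EuclideanSpace ℝ (Fin d) → ℝ → ℝ)
    (x : EuclideanSpace ℝ (Fin d)) (t : ℝ) : ℝ :=
  (1 / 4) * (Lplus u x t) ^ 2 + (1 / 2) * ePrime p ζ u x t

namespace CoulombMorawetz

/-- The Euclidean space `ℝ^d`. -/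
abbrev Euc (d : ℕ) := EuclideanSpace ℝ (Fin d)

/-- The `i`-th vector of the standard basis. -/
noncomputable abbrev basisVec {d : ℕ} (i : Fin d) : Euc d := EuclideanSpace.single i 1

variable {d : ℕ}

/-! ### Radial cutoffs -/

/-- `η` is a continuous cutoff, compactly supported away from the origin, with radial gradient
`∇η = τ x` such that `|τ| |x|² ≤ ε`. -/
structure IsCutoff (η τ : Euc d → ℝ) (ε : ℝ) : Prop where
  continuous : Continuous η
  continuous_grad : Continuous τ
  compact : HasCompactSupport η
  zero_notMem : (0 : Euc d) ∉ tsupport η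
  tsupport_grad : tsupport τ ⊆ tsupport η
  hasLineDerivAt : ∀ x i, HasLineDerivAt ℝ η (τ x * x i) x (basisVec i)
  nonneg : ∀ x, 0 ≤ η x
  le_one : ∀ x, η x ≤ 1
  grad_le : ∀ x, |τ x| * ‖x‖ ^ 2 ≤ ε

theorem continuous_cutoff_mul {X : Type*} [TopologicalSpace X] {η : Euc d → ℝ}
    (hη : Continuous η) (h0 : (0 : Euc d) ∉ tsupport η) {π : X → Euc d} (hπ : Continuous π)
    {f : X → ℝ} (hf : ∀ y, π y ≠ 0 → ContinuousAt f y) :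
    Continuous fun y => η (π y) * f y := by
  rw [continuous_iff_continuousAt]
  intro y
  by_cases hy : π y = 0
  · have : (fun y => η (π y) * f y) =ᶠ[nhds y] fun _ => 0 := by
      have hU : (tsupport η)ᶜ ∈ nhds (π y) :=
        (isClosed_tsupport η).isOpen_compl.mem_nhds (by rwa [hy])
      filter_upwards [hπ.continuousAt hU] with z hz
      rw [image_eq_zero_of_notMem_tsupport hz, zero_mul]
    exact continuousAt_const.congr this.symm
  · exact (hη.comp hπ).continuousAt.mul (hf y hy)

theorem hasLineDerivAt_norm_sq (x : Euc d) (i : Fin d) :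
    HasLineDerivAt ℝ (fun y : Euc d => ‖y‖ ^ 2) (2 * x i) x (basisVec i) := by
  have h := ((hasStrictFDerivAt_norm_sq x).hasFDerivAt).hasLineDerivAt (basisVec i)
  convert! h using 1
  simp [EuclideanSpace.inner_single_right]

theorem exists_isCutoff (d : ℕ) : ∃ K : ℝ, 0 ≤ K ∧ ∃ η τ : ℕ → Euc d → ℝ,
    (∀ n, IsCutoff (η n) (τ n) (K / (n + 1))) ∧
    ∀ x ≠ 0, Tendsto (fun n => η n x) atTop (nhds 1) := by
  let κ : ContDiffBump (0 : ℝ) := ⟨1, 2, one_pos, one_lt_two⟩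
  have hκd : Differentiable ℝ κ := κ.contDiff.differentiable (n := 1) (by simp)
  have hκc : Continuous (deriv κ) := (κ.contDiff (n := 1)).continuous_deriv le_rfl
  have hκs : HasCompactSupport (deriv κ) := κ.hasCompactSupport.deriv
  obtain ⟨B, hB⟩ := hκs.exists_bound_of_continuous hκc
  have hB0 : 0 ≤ B := (norm_nonneg _).trans (hB 0)
  have hκ0 : ∀ y : ℝ, 2 < |y| → κ y = 0 := fun y hy =>
    κ.zero_of_le_dist (by simpa [κ] using hy.le)
  have hκ'0 : ∀ y : ℝ, 2 < |y| → deriv κ y = 0 := fun y hy => by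
    have : κ =ᶠ[nhds y] fun _ => 0 := by
      filter_upwards [(isOpen_lt continuous_const continuous_abs).mem_nhds hy] with z hz
      exact hκ0 z hz
    rw [this.deriv_eq]; simp
  have hlarge : ∀ (n : ℕ) (x : Euc d), x ≠ 0 →
      ¬ (Real.exp (-(2 * (n + 1))) ≤ ‖x‖ ^ 2 ∧ ‖x‖ ^ 2 ≤ Real.exp (2 * (n + 1))) →
      2 < |Real.log (‖x‖ ^ 2) / (n + 1)| := by
    intro n x hx h
    have hs : 0 < ‖x‖ ^ 2 := by positivity
    have hn : (0 : ℝ) < n + 1 := by positivity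
    by_contra! hle
    rw [abs_div, abs_of_pos hn, div_le_iff₀ hn, abs_le] at hle
    exact h ⟨(Real.le_log_iff_exp_le hs).1 (by linarith), (Real.log_le_iff_le_exp hs).1 hle.2⟩
  let η : ℕ → Euc d → ℝ := fun n x => if x = 0 then 0 else κ (Real.log (‖x‖ ^ 2) / (n + 1))
  let τ : ℕ → Euc d → ℝ := fun n x =>
    if x = 0 then 0 else deriv κ (Real.log (‖x‖ ^ 2) / (n + 1)) * (2 / ((n + 1) * ‖x‖ ^ 2))
  refine ⟨2 * B, by positivity, η, τ, fun n => ?_, fun x hx => ?_⟩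
  · have hn : (0 : ℝ) < n + 1 := by positivity
    have hne : ∀ x : Euc d, x ≠ 0 → ∀ᶠ y in nhds x, y ≠ 0 := fun x hx =>
      isOpen_ne.mem_nhds hx
    have hηe : ∀ x : Euc d, x ≠ 0 → η n =ᶠ[nhds x] fun y => κ (Real.log (‖y‖ ^ 2) / (n + 1)) :=
      fun x hx => by filter_upwards [hne x hx] with y hy; simp [η, hy]
    have hτe : ∀ x : Euc d, x ≠ 0 → τ n =ᶠ[nhds x] fun y =>
        deriv κ (Real.log (‖y‖ ^ 2) / (n + 1)) * (2 / ((n + 1) * ‖y‖ ^ 2)) :=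
      fun x hx => by filter_upwards [hne x hx] with y hy; simp [τ, hy]
    have hsmall : ∀ᶠ y : Euc d in nhds 0, ‖y‖ ^ 2 < Real.exp (-(2 * (n + 1))) := by
      have : Continuous fun y : Euc d => ‖y‖ ^ 2 := by fun_prop
      exact this.continuousAt.eventually_lt continuousAt_const (by simpa using Real.exp_pos _)
    have hη0 : η n =ᶠ[nhds 0] fun _ => 0 := by
      filter_upwards [hsmall] with y hy
      by_cases h : y = 0
      · simp [η, h]
      · simp only [η, h, if_false]
        exact hκ0 _ (hlarge n y h fun h' => absurd h'.1 (not_le.2 hy))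
    have hτ0 : τ n =ᶠ[nhds 0] fun _ => 0 := by
      filter_upwards [hsmall] with y hy
      by_cases h : y = 0
      · simp [τ, h]
      · simp only [τ, h, if_false]
        rw [hκ'0 _ (hlarge n y h fun h' => absurd h'.1 (not_le.2 hy)), zero_mul]
    have hlogc : ∀ x : Euc d, x ≠ 0 →
        ContinuousAt (fun y : Euc d => Real.log (‖y‖ ^ 2) / (n + 1)) x := fun x hx =>
      (ContinuousAt.log (by fun_prop) (by positivity)).div_const _
    refine ⟨?_, ?_, ?_, ?_, ?_, ?_, ?_, ?_, ?_⟩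
    · refine continuous_iff_continuousAt.2 fun x => ?_
      by_cases hx : x = 0
      · subst hx; exact continuousAt_const.congr hη0.symm
      · exact (ContinuousAt.comp (g := κ) κ.continuous.continuousAt (hlogc x hx)).congr
          (hηe x hx).symm
    · refine continuous_iff_continuousAt.2 fun x => ?_
      by_cases hx : x = 0
      · subst hx; exact continuousAt_const.congr hτ0.symm
      · refine ContinuousAt.congr ?_ (hτe x hx).symm
        refine (ContinuousAt.comp (g := deriv κ) hκc.continuousAt (hlogc x hx)).mul ?_
        exact continuousAt_const.div (by fun_prop) (by positivity)
    · refine HasCompactSupport.of_support_subset_isCompact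
        (isCompact_closedBall 0 (Real.exp (n + 1))) fun x hx => ?_
      by_contra hc
      apply hx
      by_cases h : x = 0
      · simp [η, h]
      · simp only [η, h, if_false]
        refine hκ0 _ (hlarge n x h fun h' => hc ?_)
        have h2 := h'.2
        rw [two_mul, Real.exp_add, ← sq] at h2
        simpa using (abs_le_of_sq_le_sq' h2 (Real.exp_pos _).le).2
    · rw [notMem_tsupport_iff_eventuallyEq]; exact hη0
    · refine fun x hx => not_not.1 fun hc => ?_
      rw [notMem_tsupport_iff_eventuallyEq] at hc
      refine (notMem_tsupport_iff_eventuallyEq.2 ?_) hx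
      by_cases h : x = 0
      · subst h; exact hτ0
      filter_upwards [hc.eventuallyEq_nhds, hne x h, hτe x h] with y hy hy0 hyτ
      rw [hyτ]
      have hκloc : κ =ᶠ[nhds (Real.log (‖y‖ ^ 2) / (n + 1))] fun _ => 0 := by
        let ψ : ℝ → Euc d := fun z => Real.exp ((z * (n + 1) - Real.log (‖y‖ ^ 2)) / 2) • y
        have hψ : Continuous ψ := by fun_prop
        have hψy : ψ (Real.log (‖y‖ ^ 2) / (n + 1)) = y := by
          simp [ψ, div_mul_cancel₀ _ hn.ne']
        have := hψ.continuousAt.eventually (hψy.symm ▸ hy)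
        filter_upwards [this] with z hz
        have hψz : ψ z ≠ 0 := smul_ne_zero (Real.exp_pos _).ne' hy0
        simp only [η, hψz, if_false, Pi.zero_apply] at hz
        have h1 : Real.log (‖ψ z‖ ^ 2) / (n + 1) = z := by
          have hy' : ‖y‖ ≠ 0 := by simpa using hy0
          have : ‖ψ z‖ = Real.exp ((z * (n + 1) - Real.log (‖y‖ ^ 2)) / 2) * ‖y‖ := by
            simp [ψ, norm_smul]
          rw [this, mul_pow, Real.log_mul (by positivity) (by positivity), Real.log_pow,
            Real.log_exp]
          field_simp
          push_cast
          ring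
        rwa [h1] at hz
      rw [hκloc.deriv_eq]; simp
    · intro x i
      by_cases hx : x = 0
      · subst hx
        have h0 : HasLineDerivAt ℝ (fun _ : Euc d => (0 : ℝ)) 0 0 (basisVec i) :=
          HasDerivAt.congr_deriv (hasDerivAt_const _ _) rfl
        simpa using h0.congr_of_eventuallyEq hη0
      · refine HasLineDerivAt.congr_of_eventuallyEq ?_ (hηe x hx)
        have hs : (0 : ℝ) < ‖x‖ ^ 2 := by positivity
        have h1 : HasDerivAt (fun s : ℝ => ‖x + s • basisVec i‖ ^ 2) (2 * x i) 0 :=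
          hasLineDerivAt_norm_sq x i
        have h2 := (h1.log (by simpa using hx)).div_const ((n : ℝ) + 1)
        have h3 := HasDerivAt.comp (0 : ℝ) (h₂ := κ) (hκd _).hasDerivAt h2
        refine h3.congr_deriv ?_
        simp only [τ, hx, if_false, zero_smul, add_zero]
        field_simp
    · intro x
      by_cases h : x = 0 <;> simp [η, h, κ.nonneg]
    · intro x
      by_cases h : x = 0 <;> simp [η, h, κ.le_one]
    · intro x
      by_cases h : x = 0
      · simp [τ, h]; positivity
      · have hs : (0 : ℝ) < ‖x‖ ^ 2 := by positivity
        simp only [τ, h, if_false]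
        rw [abs_mul, abs_of_pos (show (0 : ℝ) < 2 / ((n + 1) * ‖x‖ ^ 2) by positivity)]
        calc _ = |deriv κ (Real.log (‖x‖ ^ 2) / (n + 1))| * (2 / (n + 1)) := by field_simp
          _ ≤ B * (2 / (n + 1)) := by gcongr; exact hB _
          _ = _ := by ring
  · have h1 : Tendsto (fun n : ℕ => Real.log (‖x‖ ^ 2) / ((n : ℝ) + 1)) atTop (nhds 0) :=
      tendsto_const_div_atTop_nhds_zero_nat (Real.log (‖x‖ ^ 2)) |>.comp
        (tendsto_add_atTop_nat 1) |>.congr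
        fun n => by simp
    have h2 := (κ.continuous.tendsto 0).comp h1
    rw [κ.one_of_mem_closedBall (Metric.mem_closedBall_self κ.rIn_pos.le)] at h2
    exact h2.congr fun n => by simp [η, hx]

/-- The divergence theorem against a radial cutoff. -/
theorem IsCutoff.integral_mul_div {η τ : Euc d → ℝ} {ε : ℝ} (hη : IsCutoff η τ ε)
    {F F' : Fin d → Euc d → ℝ}
    (hF : ∀ i, ∀ x ≠ 0, HasLineDerivAt ℝ (F i) (F' i x) x (basisVec i))
    (hFc : ∀ i, ∀ x ≠ 0, ContinuousAt (F i) x) (hFc' : ∀ i, ∀ x ≠ 0, ContinuousAt (F' i) x) :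
    ∫ x, η x * ∑ i, F' i x = - ∫ x, τ x * ∑ i, x i * F i x := by
  have h0τ : (0 : Euc d) ∉ tsupport τ := fun h => hη.zero_notMem (hη.tsupport_grad h)
  have hτc : HasCompactSupport τ := hη.compact.of_isClosed_subset (isClosed_tsupport _)
    hη.tsupport_grad
  have hi1 : ∀ i, Integrable fun x => η x * F' i x := fun i =>
    (continuous_cutoff_mul hη.continuous hη.zero_notMem continuous_id (hFc' i)
      ).integrable_of_hasCompactSupport hη.compact.mul_right
  have hi2 : ∀ i, Integrable fun x => η x * F i x := fun i =>
    (continuous_cutoff_mul hη.continuous hη.zero_notMem continuous_id (hFc i)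
      ).integrable_of_hasCompactSupport hη.compact.mul_right
  have hi3 : ∀ i, Integrable fun x => τ x * x i * F i x := fun i => by
    have : Integrable fun x => τ x * (x i * F i x) :=
      (continuous_cutoff_mul hη.continuous_grad h0τ continuous_id
        (f := fun x : Euc d => x i * F i x)
        (fun x hx => ContinuousAt.mul (by fun_prop) (hFc i x hx))
        ).integrable_of_hasCompactSupport hτc.mul_right
    simpa only [mul_assoc] using this
  have key : ∀ i, ∫ x, η x * F' i x = - ∫ x, τ x * x i * F i x := fun i =>
    integral_bilinear_hasLineDerivAt_right_eq_neg_left_of_integrable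
      (B := ContinuousLinearMap.mul ℝ ℝ) (f := η) (f' := fun x => τ x * x i) (g := F i)
      (g' := F' i) (v := basisVec i) (hi3 i) (hi1 i) (hi2 i)
      (fun x _ => hη.hasLineDerivAt x i)
      (fun x hx => hF i x (by rintro rfl; exact hη.zero_notMem hx))
  simp_rw [Finset.mul_sum, ← mul_assoc]
  rw [integral_finsetSum _ fun i _ => hi1 i, integral_finsetSum _ fun i _ => hi3 i]
  simp_rw [key, Finset.sum_neg_distrib]

/-! ### The regularised radial weights -/

/-- `q = (|x|² + δ²)^{-1/2}`, the reciprocal of the regularised radius. -/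
noncomputable def wq (δ : ℝ) (x : Euc d) : ℝ := (√(‖x‖ ^ 2 + δ ^ 2))⁻¹

/-- `b = ½Δ√(|x|² + δ²)`. -/
noncomputable def wb (δ : ℝ) (x : Euc d) : ℝ :=
  ((d : ℝ) - 1) / 2 * wq δ x + δ ^ 2 / 2 * wq δ x ^ 3

/-- The function `c` with `∇b = -c x`. -/
noncomputable def wc (δ : ℝ) (x : Euc d) : ℝ :=
  ((d : ℝ) - 1) / 2 * wq δ x ^ 3 + 3 * δ ^ 2 / 2 * wq δ x ^ 5

/-- The function `c'` with `∇c = -c' x`. -/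
noncomputable def wc' (δ : ℝ) (x : Euc d) : ℝ :=
  3 * ((d : ℝ) - 1) / 2 * wq δ x ^ 5 + 15 * δ ^ 2 / 2 * wq δ x ^ 7

theorem wq_pos {δ : ℝ} (hδ : 0 < δ) (x : Euc d) : 0 < wq δ x := by unfold wq; positivity

theorem wq_sq {δ : ℝ} (hδ : 0 < δ) (x : Euc d) : wq δ x ^ 2 * (‖x‖ ^ 2 + δ ^ 2) = 1 := by
  have h : 0 < ‖x‖ ^ 2 + δ ^ 2 := by positivity
  rw [wq, inv_pow, Real.sq_sqrt h.le, inv_mul_cancel₀ h.ne']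

theorem natCast_mul_wq_sub {δ : ℝ} (hδ : 0 < δ) (x : Euc d) :
    d * wq δ x - ‖x‖ ^ 2 * wq δ x ^ 3 = 2 * wb δ x := by
  have : ‖x‖ ^ 2 * wq δ x ^ 3 = wq δ x * (1 - δ ^ 2 * wq δ x ^ 2) := by rw [← wq_sq hδ x]; ring
  rw [this, wb]; ring

theorem continuous_wq {δ : ℝ} (hδ : 0 < δ) : Continuous (wq δ : Euc d → ℝ) := by
  unfold wq
  exact Continuous.inv₀ (by fun_prop) fun x => by positivity

theorem hasLineDerivAt_wq {δ : ℝ} (hδ : 0 < δ) (x : Euc d) (i : Fin d) :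
    HasLineDerivAt ℝ (wq δ) (-(x i * wq δ x ^ 3)) x (basisVec i) := by
  have h0 : 0 < ‖x‖ ^ 2 + δ ^ 2 := by positivity
  have h1 : HasDerivAt (fun s : ℝ => ‖x + s • basisVec i‖ ^ 2) (2 * x i) 0 :=
    hasLineDerivAt_norm_sq x i
  have h2 := ((h1.add_const (δ ^ 2)).sqrt (by simpa using h0.ne')).inv
    (by simpa using (Real.sqrt_pos.2 h0).ne')
  refine h2.congr_deriv ?_
  have hs := (Real.sqrt_pos.2 h0).ne'
  simp only [zero_smul, add_zero, wq]
  field_simp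

theorem hasLineDerivAt_coord (x : Euc d) (i j : Fin d) :
    HasLineDerivAt ℝ (fun y : Euc d => y j) (if j = i then 1 else 0) x (basisVec i) := by
  have : HasDerivAt (fun s : ℝ => x j + s * (if j = i then 1 else 0)) (if j = i then 1 else 0) 0 :=
    (((hasDerivAt_id (0 : ℝ)).mul_const (if j = i then (1 : ℝ) else 0)).const_add (x j)).congr_deriv
      (by simp)
  refine this.congr_of_eventuallyEq (.of_forall fun s => ?_)
  simp [basisVec]

theorem hasLineDerivAt_norm_inv {x : Euc d} (hx : x ≠ 0) (i : Fin d) :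
    HasLineDerivAt ℝ (fun y : Euc d => ‖y‖⁻¹) (-(x i / ‖x‖ ^ 3)) x (basisVec i) := by
  have h0 : 0 < ‖x‖ := norm_pos_iff.2 hx
  have h1 : HasDerivAt (fun s : ℝ => ‖x + s • basisVec i‖ ^ 2) (2 * x i) 0 :=
    hasLineDerivAt_norm_sq x i
  have h2 := (h1.sqrt (by simpa using hx)).inv (by simpa using hx)
  have h3 : HasDerivAt (fun s : ℝ => ‖x + s • basisVec i‖⁻¹) _ 0 :=
    h2.congr_of_eventuallyEq (.of_forall fun s => by simp [Real.sqrt_sq])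
  refine h3.congr_deriv ?_
  simp only [zero_smul, add_zero, Real.sqrt_sq h0.le]
  field_simp

/-! ### The jet of a solution and the Morawetz identity -/

/-- A function on space-time together with candidates for its first and second derivatives:
`w = ∂ₜv`, `z = ∂ₜ²v`, `g i = ∂ᵢv`, `k i = ∂ᵢ∂ₜv`, `h i j = ∂ⱼ∂ᵢv`. -/
structure Jet (d : ℕ) where
  v : Euc d × ℝ → ℝ
  w : Euc d × ℝ → ℝ
  z : Euc d × ℝ → ℝ
  g : Fin d → Euc d × ℝ → ℝ
  k : Fin d → Euc d × ℝ → ℝ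
  h : Fin d → Fin d → Euc d × ℝ → ℝ

namespace Jet

/-- The jet is that of a `C²` solution of the Coulomb wave equation away from the origin. -/
structure IsSolution (J : Jet d) (p ζ : ℝ) : Prop where
  continuousAt_v : ∀ x ≠ 0, ∀ t, ContinuousAt J.v (x, t)
  continuousAt_w : ∀ x ≠ 0, ∀ t, ContinuousAt J.w (x, t)
  continuousAt_z : ∀ x ≠ 0, ∀ t, ContinuousAt J.z (x, t)
  continuousAt_g : ∀ i, ∀ x ≠ 0, ∀ t, ContinuousAt (J.g i) (x, t)
  continuousAt_k : ∀ i, ∀ x ≠ 0, ∀ t, ContinuousAt (J.k i) (x, t)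
  continuousAt_h : ∀ i j, ∀ x ≠ 0, ∀ t, ContinuousAt (J.h i j) (x, t)
  hasLineDerivAt_v : ∀ i, ∀ x ≠ 0, ∀ t,
    HasLineDerivAt ℝ (fun y => J.v (y, t)) (J.g i (x, t)) x (basisVec i)
  hasLineDerivAt_g : ∀ j i, ∀ x ≠ 0, ∀ t,
    HasLineDerivAt ℝ (fun y => J.g j (y, t)) (J.h j i (x, t)) x (basisVec i)
  hasLineDerivAt_w : ∀ i, ∀ x ≠ 0, ∀ t,
    HasLineDerivAt ℝ (fun y => J.w (y, t)) (J.k i (x, t)) x (basisVec i)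
  hasDerivAt_v : ∀ x ≠ 0, ∀ t, HasDerivAt (fun s => J.v (x, s)) (J.w (x, t)) t
  hasDerivAt_g : ∀ i, ∀ x ≠ 0, ∀ t, HasDerivAt (fun s => J.g i (x, s)) (J.k i (x, t)) t
  hasDerivAt_w : ∀ x ≠ 0, ∀ t, HasDerivAt (fun s => J.w (x, s)) (J.z (x, t)) t
  symm : ∀ i j, ∀ x ≠ 0, ∀ t, J.h i j (x, t) = J.h j i (x, t)
  equation : ∀ x ≠ 0, ∀ t, J.z (x, t) - ∑ i, J.h i i (x, t) + J.v (x, t) / ‖x‖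
    + ζ * |J.v (x, t)| ^ (p - 1) * J.v (x, t) = 0

variable (J : Jet d) (p ζ δ : ℝ)

/-- `x · ∇v` -/
noncomputable def radial (y : Euc d × ℝ) : ℝ := ∑ j, y.1 j * J.g j y

/-- `|∇v|²` -/
noncomputable def gradSq (y : Euc d × ℝ) : ℝ := ∑ j, J.g j y ^ 2

/-- The Morawetz multiplier `∇φ · ∇v + ½Δφ v` for `φ = √(|x|² + δ²)`. -/
noncomputable def mult (y : Euc d × ℝ) : ℝ := wq δ y.1 * J.radial y + wb δ y.1 * J.v y

/-- The Lagrangian density. -/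
noncomputable def lagr (y : Euc d × ℝ) : ℝ :=
  1 / 2 * (J.w y ^ 2 - J.gradSq y - J.v y ^ 2 * ‖y.1‖⁻¹ - 2 * ζ * (|J.v y| ^ (p + 1) / (p + 1)))

/-- The derivative of `lagr` in the `i`-th direction. -/
noncomputable def lagrDeriv (i : Fin d) (y : Euc d × ℝ) : ℝ :=
  J.w y * J.k i y - ∑ j, J.g j y * J.h j i y - J.v y * J.g i y * ‖y.1‖⁻¹
    + J.v y ^ 2 / 2 * (y.1 i / ‖y.1‖ ^ 3) - ζ * (|J.v y| ^ (p - 1) * J.v y) * J.g i y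

/-- The flux of the Morawetz identity. -/
noncomputable def flux (i : Fin d) (y : Euc d × ℝ) : ℝ :=
  J.g i y * J.mult δ y + y.1 i * wq δ y.1 * J.lagr p ζ y + 1 / 2 * y.1 i * wc δ y.1 * J.v y ^ 2

/-- The derivative of `flux i` in the `i`-th direction. -/
noncomputable def fluxDeriv (i : Fin d) (y : Euc d × ℝ) : ℝ :=
  J.h i i y * J.mult δ y
    + J.g i y * (-(y.1 i * wq δ y.1 ^ 3) * J.radial y
        + wq δ y.1 * (J.g i y + ∑ j, y.1 j * J.h j i y)
        - y.1 i * wc δ y.1 * J.v y + wb δ y.1 * J.g i y)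
    + (wq δ y.1 - y.1 i ^ 2 * wq δ y.1 ^ 3) * J.lagr p ζ y
    + y.1 i * wq δ y.1 * J.lagrDeriv p ζ i y
    + 1 / 2 * (wc δ y.1 - y.1 i ^ 2 * wc' δ y.1) * J.v y ^ 2
    + y.1 i * wc δ y.1 * J.v y * J.g i y

/-- The time derivative of `w * mult`. -/
noncomputable def momDeriv (y : Euc d × ℝ) : ℝ :=
  J.z y * J.mult δ y + J.w y * (wq δ y.1 * (∑ j, y.1 j * J.k j y) + wb δ y.1 * J.w y)

/-- The bulk term of the Morawetz identity. -/
noncomputable def bulk (y : Euc d × ℝ) : ℝ :=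
  wq δ y.1 * J.gradSq y - wq δ y.1 ^ 3 * J.radial y ^ 2
    + 1 / 2 * wq δ y.1 * J.v y ^ 2 * ‖y.1‖⁻¹
    + ζ * wb δ y.1 * ((p - 1) / (p + 1) * |J.v y| ^ (p + 1))
    + 1 / 2 * (d * wc δ y.1 - ‖y.1‖ ^ 2 * wc' δ y.1) * J.v y ^ 2

variable {J p ζ δ}

theorem abs_rpow_mul_sq (hp : 1 < p) (a : ℝ) : |a| ^ (p - 1) * a * a = |a| ^ (p + 1) := by
  have h2 : a * a = |a| ^ (2 : ℝ) := by rw [Real.rpow_two, sq_abs, sq]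
  rw [mul_assoc, h2, ← Real.rpow_add_of_nonneg (abs_nonneg a) (by linarith) (by norm_num)]
  congr 1; ring

theorem IsSolution.sum_fluxDeriv (hJ : J.IsSolution p ζ) (hp : 1 < p) (hδ : 0 < δ)
    {x : Euc d} (hx : x ≠ 0) (t : ℝ) :
    ∑ i, J.fluxDeriv p ζ δ i (x, t) = J.momDeriv δ (x, t) + J.bulk p ζ δ (x, t) := by
  have hr : ‖x‖ ^ 2 = ∑ i, x i ^ 2 := EuclideanSpace.real_norm_sq_eq x
  have hr0 : ‖x‖ ≠ 0 := norm_ne_zero_iff.2 hx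
  have heq := hJ.equation x hx t
  have hpow := abs_rpow_mul_sq hp (J.v (x, t))
  have hcross : ∑ i, x i * ∑ j, J.g j (x, t) * J.h j i (x, t)
      = ∑ i, J.g i (x, t) * ∑ j, x j * J.h j i (x, t) := by
    simp_rw [Finset.mul_sum]
    rw [Finset.sum_comm]
    refine Finset.sum_congr rfl fun j _ => Finset.sum_congr rfl fun i _ => ?_
    rw [hJ.symm j i x hx t]; ring
  have expand : ∑ i, J.fluxDeriv p ζ δ i (x, t) =
      (∑ i, J.h i i (x, t)) * J.mult δ (x, t)
      + (∑ i, x i * J.g i (x, t)) * (-(wq δ x ^ 3 * J.radial (x, t))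
          - wq δ x * J.v (x, t) * ‖x‖⁻¹
          - wq δ x * (ζ * (|J.v (x, t)| ^ (p - 1) * J.v (x, t))))
      + (∑ i, J.g i (x, t) ^ 2) * (wq δ x + wb δ x)
      + (∑ i, J.g i (x, t) * ∑ j, x j * J.h j i (x, t)) * wq δ x
      + (d * wq δ x - (∑ i, x i ^ 2) * wq δ x ^ 3) * J.lagr p ζ (x, t)
      + (∑ i, x i * J.k i (x, t)) * (wq δ x * J.w (x, t))
      - (∑ i, x i * ∑ j, J.g j (x, t) * J.h j i (x, t)) * wq δ x
      + (∑ i, x i ^ 2) * (wq δ x * (J.v (x, t) ^ 2 / 2 / ‖x‖ ^ 3))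
      + 1 / 2 * (d * wc δ x - (∑ i, x i ^ 2) * wc' δ x) * J.v (x, t) ^ 2 := by
    have hd : ∀ a : ℝ, (d : ℝ) * a = ∑ _i : Fin d, a := fun a => by simp
    rw [hd, hd]
    simp only [Finset.sum_mul, ← Finset.sum_sub_distrib, ← Finset.sum_add_distrib,
      Finset.mul_sum (Finset.univ) _ (1 / 2 : ℝ)]
    refine Finset.sum_congr rfl fun i _ => ?_
    simp only [fluxDeriv, lagrDeriv]
    ring
  rw [expand, hcross, ← hr]
  simp only [momDeriv, bulk, mult, lagr]
  rw [← hpow]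
  simp only [radial, gradSq]
  have hz : J.z (x, t) = ∑ i, J.h i i (x, t) - J.v (x, t) / ‖x‖
    - ζ * |J.v (x, t)| ^ (p - 1) * J.v (x, t) := by linarith
  have hp1 : p + 1 ≠ 0 := by linarith
  rw [natCast_mul_wq_sub hδ, hz]
  field_simp
  ring

end Jet

/-! ### Differentiability and continuity of the densities -/

theorem wb_hasLineDerivAt {δ : ℝ} (hδ : 0 < δ) (x : Euc d) (i : Fin d) :
    HasLineDerivAt ℝ (wb δ) (-(x i * wc δ x)) x (basisVec i) := by
  have h : HasDerivAt (fun s : ℝ => wq δ (x + s • basisVec i)) _ 0 := hasLineDerivAt_wq hδ x i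
  refine ((h.const_mul (((d : ℝ) - 1) / 2)).add ((h.pow 3).const_mul (δ ^ 2 / 2))).congr_deriv ?_
  simp only [zero_smul, add_zero, wc]
  ring

theorem wc_hasLineDerivAt {δ : ℝ} (hδ : 0 < δ) (x : Euc d) (i : Fin d) :
    HasLineDerivAt ℝ (wc δ) (-(x i * wc' δ x)) x (basisVec i) := by
  have h : HasDerivAt (fun s : ℝ => wq δ (x + s • basisVec i)) _ 0 := hasLineDerivAt_wq hδ x i
  refine (((h.pow 3).const_mul (((d : ℝ) - 1) / 2)).add
    ((h.pow 5).const_mul (3 * δ ^ 2 / 2))).congr_deriv ?_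
  simp only [zero_smul, add_zero, wc']
  ring

theorem continuous_wb {δ : ℝ} (hδ : 0 < δ) : Continuous (wb δ : Euc d → ℝ) := by
  have := continuous_wq (d := d) hδ
  unfold wb; fun_prop

theorem continuous_wc {δ : ℝ} (hδ : 0 < δ) : Continuous (wc δ : Euc d → ℝ) := by
  have := continuous_wq (d := d) hδ
  unfold wc; fun_prop

theorem continuous_wc' {δ : ℝ} (hδ : 0 < δ) : Continuous (wc' δ : Euc d → ℝ) := by
  have := continuous_wq (d := d) hδ
  unfold wc'; fun_prop

theorem continuous_abs_rpow {r : ℝ} (hr : 0 ≤ r) : Continuous fun a : ℝ => |a| ^ r :=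
  continuous_abs.rpow_const fun _ => Or.inr hr

namespace Jet

variable {J : Jet d} {p ζ δ : ℝ}

theorem IsSolution.hasLineDerivAt_radial (hJ : J.IsSolution p ζ) {x : Euc d} (hx : x ≠ 0) (t : ℝ)
    (i : Fin d) : HasLineDerivAt ℝ (fun y => J.radial (y, t))
      (J.g i (x, t) + ∑ j, x j * J.h j i (x, t)) x (basisVec i) := by
  have hg : ∀ j, HasDerivAt (fun s : ℝ => J.g j (x + s • basisVec i, t)) _ 0 :=
    fun j => hJ.hasLineDerivAt_g j i x hx t
  have hc : ∀ j, HasDerivAt (fun s : ℝ => (x + s • basisVec i : Euc d) j) _ 0 :=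
    fun j => hasLineDerivAt_coord x i j
  refine (HasDerivAt.fun_sum fun j (_ : j ∈ Finset.univ) => (hc j).mul (hg j)).congr_deriv ?_
  simp only [zero_smul, add_zero, Finset.sum_add_distrib, ite_mul, one_mul, zero_mul,
    Finset.sum_ite_eq', Finset.mem_univ, if_true]

theorem IsSolution.hasLineDerivAt_mult (hJ : J.IsSolution p ζ) (hδ : 0 < δ) {x : Euc d}
    (hx : x ≠ 0) (t : ℝ) (i : Fin d) : HasLineDerivAt ℝ (fun y => J.mult δ (y, t))
      (-(x i * wq δ x ^ 3) * J.radial (x, t)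
        + wq δ x * (J.g i (x, t) + ∑ j, x j * J.h j i (x, t))
        - x i * wc δ x * J.v (x, t) + wb δ x * J.g i (x, t)) x (basisVec i) := by
  have hq : HasDerivAt (fun s : ℝ => wq δ (x + s • basisVec i)) _ 0 := hasLineDerivAt_wq hδ x i
  have hb : HasDerivAt (fun s : ℝ => wb δ (x + s • basisVec i)) _ 0 := wb_hasLineDerivAt hδ x i
  have hr : HasDerivAt (fun s : ℝ => J.radial (x + s • basisVec i, t)) _ 0 :=
    hJ.hasLineDerivAt_radial hx t i
  have hv : HasDerivAt (fun s : ℝ => J.v (x + s • basisVec i, t)) _ 0 :=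
    hJ.hasLineDerivAt_v i x hx t
  refine ((hq.mul hr).add (hb.mul hv)).congr_deriv ?_
  simp only [zero_smul, add_zero]
  ring

theorem IsSolution.hasLineDerivAt_lagr (hJ : J.IsSolution p ζ) (hp : 1 < p) {x : Euc d}
    (hx : x ≠ 0) (t : ℝ) (i : Fin d) : HasLineDerivAt ℝ (fun y => J.lagr p ζ (y, t))
      (J.lagrDeriv p ζ i (x, t)) x (basisVec i) := by
  have hg : ∀ j, HasDerivAt (fun s : ℝ => J.g j (x + s • basisVec i, t)) _ 0 :=
    fun j => hJ.hasLineDerivAt_g j i x hx t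
  have hv : HasDerivAt (fun s : ℝ => J.v (x + s • basisVec i, t)) _ 0 :=
    hJ.hasLineDerivAt_v i x hx t
  have hw : HasDerivAt (fun s : ℝ => J.w (x + s • basisVec i, t)) _ 0 :=
    hJ.hasLineDerivAt_w i x hx t
  have hn : HasDerivAt (fun s : ℝ => ‖x + s • basisVec i‖⁻¹) _ 0 := hasLineDerivAt_norm_inv hx i
  have hS := HasDerivAt.fun_sum fun j (_ : j ∈ Finset.univ) => (hg j).pow 2
  have hp1 : p + 1 ≠ 0 := by linarith
  have hF := (HasDerivAt.comp (0 : ℝ)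
    (hasDerivAt_abs_rpow (J.v (x + (0 : ℝ) • basisVec i, t)) (p := p + 1) (by linarith)) hv
    ).div_const (p + 1)
  refine (((((hw.pow 2).sub hS).sub ((hv.pow 2).mul hn)).sub (hF.const_mul (2 * ζ))).const_mul
    (1 / 2)).congr_deriv ?_
  simp only [Pi.pow_apply, zero_smul, add_zero, lagrDeriv]
  have hs : ∑ j, (2 : ℕ) * J.g j (x, t) ^ (2 - 1) * J.h j i (x, t)
      = 2 * ∑ j, J.g j (x, t) * J.h j i (x, t) := by
    rw [Finset.mul_sum]; refine Finset.sum_congr rfl fun j _ => ?_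
    push_cast; ring
  rw [hs, show p + 1 - 2 = p - 1 by ring]
  field_simp
  push_cast
  ring

theorem IsSolution.hasLineDerivAt_flux (hJ : J.IsSolution p ζ) (hp : 1 < p) (hδ : 0 < δ)
    {x : Euc d} (hx : x ≠ 0) (t : ℝ) (i : Fin d) :
    HasLineDerivAt ℝ (fun y => J.flux p ζ δ i (y, t)) (J.fluxDeriv p ζ δ i (x, t)) x
      (basisVec i) := by
  have hg : HasDerivAt (fun s : ℝ => J.g i (x + s • basisVec i, t)) _ 0 :=
    hJ.hasLineDerivAt_g i i x hx t
  have hv : HasDerivAt (fun s : ℝ => J.v (x + s • basisVec i, t)) _ 0 :=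
    hJ.hasLineDerivAt_v i x hx t
  have hc : HasDerivAt (fun s : ℝ => (x + s • basisVec i : Euc d) i) _ 0 :=
    hasLineDerivAt_coord x i i
  have hq : HasDerivAt (fun s : ℝ => wq δ (x + s • basisVec i)) _ 0 := hasLineDerivAt_wq hδ x i
  have hwc : HasDerivAt (fun s : ℝ => wc δ (x + s • basisVec i)) _ 0 := wc_hasLineDerivAt hδ x i
  have hm : HasDerivAt (fun s : ℝ => J.mult δ (x + s • basisVec i, t)) _ 0 :=
    hJ.hasLineDerivAt_mult hδ hx t i
  have hl : HasDerivAt (fun s : ℝ => J.lagr p ζ (x + s • basisVec i, t)) _ 0 :=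
    hJ.hasLineDerivAt_lagr hp hx t i
  refine (((hg.mul hm).add ((hc.mul hq).mul hl)).add
    (((hc.const_mul (1 / 2)).mul hwc).mul (hv.pow 2))).congr_deriv ?_
  simp only [zero_smul, add_zero, fluxDeriv, if_true, Pi.mul_apply,
    Pi.pow_apply]
  push_cast
  ring

theorem IsSolution.hasDerivAt_mom (hJ : J.IsSolution p ζ) {x : Euc d} (hx : x ≠ 0) (t : ℝ) :
    HasDerivAt (fun s => J.w (x, s) * J.mult δ (x, s)) (J.momDeriv δ (x, t)) t := by
  have hr : HasDerivAt (fun s => J.radial (x, s)) _ t :=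
    HasDerivAt.fun_sum fun j (_ : j ∈ Finset.univ) => (hJ.hasDerivAt_g j x hx t).const_mul (x j)
  refine ((hJ.hasDerivAt_w x hx t).mul
    ((hr.const_mul (wq δ x)).add ((hJ.hasDerivAt_v x hx t).const_mul (wb δ x)))).congr_deriv ?_
  rfl

theorem IsSolution.continuousAt_radial (hJ : J.IsSolution p ζ) {x : Euc d} (hx : x ≠ 0) (t : ℝ) :
    ContinuousAt J.radial (x, t) :=
  tendsto_finsetSum _ fun i _ =>
    ContinuousAt.mul (f := fun y : Euc d × ℝ => y.1 i) (by fun_prop) (hJ.continuousAt_g i x hx t)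

theorem IsSolution.continuousAt_gradSq (hJ : J.IsSolution p ζ) {x : Euc d} (hx : x ≠ 0) (t : ℝ) :
    ContinuousAt J.gradSq (x, t) :=
  tendsto_finsetSum _ fun i _ => (hJ.continuousAt_g i x hx t).pow 2

theorem continuousAt_fst_comp {f : Euc d → ℝ} (hf : Continuous f) (y : Euc d × ℝ) :
    ContinuousAt (fun y : Euc d × ℝ => f y.1) y := (hf.comp continuous_fst).continuousAt

theorem IsSolution.continuousAt_mult (hJ : J.IsSolution p ζ) (hδ : 0 < δ) {x : Euc d}
    (hx : x ≠ 0) (t : ℝ) : ContinuousAt (J.mult δ) (x, t) :=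
  ((continuousAt_fst_comp (continuous_wq hδ) _).mul (hJ.continuousAt_radial hx t)).add
    ((continuousAt_fst_comp (continuous_wb hδ) _).mul (hJ.continuousAt_v x hx t))

theorem continuousAt_norm_inv {x : Euc d} (hx : x ≠ 0) (t : ℝ) :
    ContinuousAt (fun y : Euc d × ℝ => ‖y.1‖⁻¹) (x, t) :=
  ContinuousAt.inv₀ (by fun_prop) (by simpa using hx)

theorem IsSolution.continuousAt_lagr (hJ : J.IsSolution p ζ) (hp : 1 < p) {x : Euc d}
    (hx : x ≠ 0) (t : ℝ) : ContinuousAt (J.lagr p ζ) (x, t) := by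
  have h1 := hJ.continuousAt_v x hx t
  have h2 := hJ.continuousAt_w x hx t
  have h3 := hJ.continuousAt_gradSq hx t
  have h4 := continuousAt_norm_inv hx t
  have h5 : ContinuousAt (fun y => |J.v y| ^ (p + 1)) (x, t) :=
    (continuous_abs_rpow (by linarith)).continuousAt.comp h1
  unfold lagr
  fun_prop

theorem IsSolution.continuousAt_lagrDeriv (hJ : J.IsSolution p ζ) (hp : 1 < p) {x : Euc d}
    (hx : x ≠ 0) (t : ℝ) (i : Fin d) : ContinuousAt (J.lagrDeriv p ζ i) (x, t) := by
  have h1 := hJ.continuousAt_v x hx t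
  have h2 := hJ.continuousAt_w x hx t
  have h3 := hJ.continuousAt_k i x hx t
  have h4 := continuousAt_norm_inv hx t
  have h5 : ContinuousAt (fun y => |J.v y| ^ (p - 1)) (x, t) :=
    (continuous_abs_rpow (by linarith)).continuousAt.comp h1
  have h6 : ContinuousAt (fun y => ∑ j, J.g j y * J.h j i y) (x, t) :=
    tendsto_finsetSum _ fun j _ => (hJ.continuousAt_g j x hx t).mul (hJ.continuousAt_h j i x hx t)
  have h7 := hJ.continuousAt_g i x hx t
  have h8 : ContinuousAt (fun y : Euc d × ℝ => y.1 i / ‖y.1‖ ^ 3) (x, t) :=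
    ContinuousAt.div (by fun_prop) (by fun_prop) (by simpa using hx)
  unfold lagrDeriv
  fun_prop

theorem IsSolution.continuousAt_flux (hJ : J.IsSolution p ζ) (hp : 1 < p) (hδ : 0 < δ)
    {x : Euc d} (hx : x ≠ 0) (t : ℝ) (i : Fin d) : ContinuousAt (J.flux p ζ δ i) (x, t) := by
  have h1 := hJ.continuousAt_v x hx t
  have h2 := hJ.continuousAt_g i x hx t
  have h3 := hJ.continuousAt_mult hδ hx t
  have h4 := hJ.continuousAt_lagr hp hx t
  have h5 := continuousAt_fst_comp (continuous_wq hδ) (x, t)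
  have h6 := continuousAt_fst_comp (continuous_wc hδ) (x, t)
  unfold flux
  fun_prop

theorem IsSolution.continuousAt_fluxDeriv (hJ : J.IsSolution p ζ) (hp : 1 < p) (hδ : 0 < δ)
    {x : Euc d} (hx : x ≠ 0) (t : ℝ) (i : Fin d) : ContinuousAt (J.fluxDeriv p ζ δ i) (x, t) := by
  have h1 := hJ.continuousAt_v x hx t
  have h2 := hJ.continuousAt_g i x hx t
  have h3 := hJ.continuousAt_mult hδ hx t
  have h4 := hJ.continuousAt_lagr hp hx t
  have h5 := continuousAt_fst_comp (continuous_wq hδ) (x, t)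
  have h6 := continuousAt_fst_comp (continuous_wc hδ) (x, t)
  have h7 := continuousAt_fst_comp (continuous_wb hδ) (x, t)
  have h8 := continuousAt_fst_comp (continuous_wc' hδ) (x, t)
  have h9 := hJ.continuousAt_lagrDeriv hp hx t i
  have h10 := hJ.continuousAt_h i i x hx t
  have h11 := hJ.continuousAt_radial hx t
  have h12 : ContinuousAt (fun y : Euc d × ℝ => ∑ j, y.1 j * J.h j i y) (x, t) :=
    tendsto_finsetSum _ fun j _ => ContinuousAt.mul (f := fun y : Euc d × ℝ => y.1 j)
      (by fun_prop) (hJ.continuousAt_h j i x hx t)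
  unfold fluxDeriv
  fun_prop

theorem IsSolution.continuousAt_momDeriv (hJ : J.IsSolution p ζ) (hδ : 0 < δ)
    {x : Euc d} (hx : x ≠ 0) (t : ℝ) : ContinuousAt (J.momDeriv δ) (x, t) := by
  have h1 := hJ.continuousAt_w x hx t
  have h2 := hJ.continuousAt_z x hx t
  have h3 := hJ.continuousAt_mult hδ hx t
  have h5 := continuousAt_fst_comp (continuous_wq hδ) (x, t)
  have h7 := continuousAt_fst_comp (continuous_wb hδ) (x, t)
  have h12 : ContinuousAt (fun y : Euc d × ℝ => ∑ j, y.1 j * J.k j y) (x, t) :=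
    tendsto_finsetSum _ fun j _ => ContinuousAt.mul (f := fun y : Euc d × ℝ => y.1 j)
      (by fun_prop) (hJ.continuousAt_k j x hx t)
  unfold momDeriv
  fun_prop

theorem IsSolution.continuousAt_bulk (hJ : J.IsSolution p ζ) (hp : 1 < p) (hδ : 0 < δ)
    {x : Euc d} (hx : x ≠ 0) (t : ℝ) : ContinuousAt (J.bulk p ζ δ) (x, t) := by
  have h1 := hJ.continuousAt_v x hx t
  have h2 := hJ.continuousAt_radial hx t
  have h3 := hJ.continuousAt_gradSq hx t
  have h4 := continuousAt_norm_inv hx t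
  have h5 := continuousAt_fst_comp (continuous_wq hδ) (x, t)
  have h6 := continuousAt_fst_comp (continuous_wc hδ) (x, t)
  have h7 := continuousAt_fst_comp (continuous_wb hδ) (x, t)
  have h8 := continuousAt_fst_comp (continuous_wc' hδ) (x, t)
  have h9 : ContinuousAt (fun y => |J.v y| ^ (p + 1)) (x, t) :=
    (continuous_abs_rpow (by linarith)).continuousAt.comp h1
  unfold bulk
  fun_prop

/-! ### Pointwise bounds -/

theorem radial_sq_le (y : Euc d × ℝ) : J.radial y ^ 2 ≤ ‖y.1‖ ^ 2 * J.gradSq y := by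
  rw [EuclideanSpace.real_norm_sq_eq]
  exact Finset.sum_mul_sq_le_sq_mul_sq _ _ _

theorem gradSq_nonneg (y : Euc d × ℝ) : 0 ≤ J.gradSq y :=
  Finset.sum_nonneg fun _ _ => sq_nonneg _

end Jet

theorem wq_sq_mul_le {δ : ℝ} (hδ : 0 < δ) (x : Euc d) :
    wq δ x ^ 2 * ‖x‖ ^ 2 ≤ 1 ∧ δ ^ 2 * wq δ x ^ 2 ≤ 1 := by
  have h := wq_sq hδ x
  constructor
  · nlinarith [mul_nonneg (sq_nonneg (wq δ x)) (sq_nonneg δ)]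
  · nlinarith [mul_nonneg (sq_nonneg (wq δ x)) (sq_nonneg ‖x‖)]

theorem wb_nonneg {δ : ℝ} (hd : 4 ≤ d) (hδ : 0 < δ) (x : Euc d) : 0 ≤ wb δ x := by
  have := wq_pos hδ x
  have hd' : (4 : ℝ) ≤ d := by exact_mod_cast hd
  have : 0 ≤ (d : ℝ) - 1 := by linarith
  unfold wb; positivity

theorem wc_nonneg {δ : ℝ} (hd : 4 ≤ d) (hδ : 0 < δ) (x : Euc d) : 0 ≤ wc δ x := by
  have := wq_pos hδ x
  have hd' : (4 : ℝ) ≤ d := by exact_mod_cast hd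
  have : 0 ≤ (d : ℝ) - 1 := by linarith
  unfold wc; positivity

/-- `-Δ²φ ≥ 0` for `φ = √(|x|² + δ²)` in dimension at least four. -/
theorem bilaplacian_nonneg {δ : ℝ} (hd : 4 ≤ d) (hδ : 0 < δ) (x : Euc d) :
    0 ≤ d * wc δ x - ‖x‖ ^ 2 * wc' δ x := by
  have hq := wq_pos hδ x
  have hd' : (4 : ℝ) ≤ d := by exact_mod_cast hd
  have h : ‖x‖ ^ 2 * wq δ x ^ 2 = 1 - δ ^ 2 * wq δ x ^ 2 := by rw [← wq_sq hδ x]; ring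
  have e : d * wc δ x - ‖x‖ ^ 2 * wc' δ x = wq δ x ^ 3 * (((d : ℝ) - 1) * (d - 3) / 2
      + (3 * d - 9) * (δ ^ 2 * wq δ x ^ 2) + 15 / 2 * (δ ^ 2 * wq δ x ^ 2) ^ 2) := by
    have : ‖x‖ ^ 2 * wc' δ x = (‖x‖ ^ 2 * wq δ x ^ 2) * wq δ x ^ 3
      * (3 * ((d : ℝ) - 1) / 2 + 15 * δ ^ 2 / 2 * wq δ x ^ 2) := by unfold wc'; ring
    rw [this, h, wc]; ring
  rw [e]
  have h1 : 0 ≤ ((d : ℝ) - 1) * (d - 3) / 2 := by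
    have : 0 ≤ ((d : ℝ) - 1) * (d - 3) := mul_nonneg (by linarith) (by linarith)
    linarith
  have h2 : (0 : ℝ) ≤ 3 * d - 9 := by linarith
  positivity

theorem exists_weight_bound {δ : ℝ} (hd : 4 ≤ d) (hδ : 0 < δ) : ∃ C : ℝ, 0 < C ∧ ∀ x : Euc d,
    wq δ x ≤ C ∧ wb δ x ≤ C ∧ wc δ x ≤ C * wq δ x := by
  have hd' : (4 : ℝ) ≤ d := by exact_mod_cast hd
  refine ⟨d * (δ⁻¹ + δ⁻¹ ^ 2), by positivity, fun x => ?_⟩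
  have hq := wq_pos hδ x
  have hi : 0 < δ⁻¹ := by positivity
  have h1 := (wq_sq_mul_le hδ x).2
  have h2 : wq δ x ≤ δ⁻¹ := by
    rw [← mul_pow] at h1
    have := (abs_le_of_sq_le_sq' (by simpa using h1 : (δ * wq δ x) ^ 2 ≤ 1 ^ 2) one_pos.le).2
    rw [← one_div, le_div_iff₀ hδ]; linarith
  have h3 : wq δ x ^ 2 ≤ δ⁻¹ ^ 2 := by gcongr
  have h0 : 0 ≤ δ ^ 2 * wq δ x ^ 2 := by positivity
  refine ⟨?_, ?_, ?_⟩
  · nlinarith [sq_nonneg δ⁻¹]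
  · have : wb δ x = wq δ x * (((d : ℝ) - 1) / 2 + (δ ^ 2 * wq δ x ^ 2) / 2) := by unfold wb; ring
    rw [this]
    calc _ ≤ wq δ x * d := by gcongr; linarith
      _ ≤ _ := by nlinarith [sq_nonneg δ⁻¹]
  · have : wc δ x = wq δ x ^ 2 * wq δ x * (((d : ℝ) - 1) / 2 + 3 * (δ ^ 2 * wq δ x ^ 2) / 2) := by
      unfold wc; ring
    rw [this]
    calc _ ≤ δ⁻¹ ^ 2 * wq δ x * d := by gcongr <;> linarith
      _ ≤ _ := by nlinarith [mul_pos hi hq, mul_pos (mul_pos hi hq) (show (0 : ℝ) < d by linarith)]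

theorem ae_ne_zero (hd : 4 ≤ d) : ∀ᵐ x : Euc d, x ≠ 0 := by
  have : NeZero d := ⟨by omega⟩
  have : Nontrivial (Euc d) := inferInstance
  exact Measure.ae_ne volume (0 : Euc d)

theorem integrableOn_norm_inv_sq (hd : 4 ≤ d) :
    IntegrableOn (fun x : Euc d => (‖x‖ ^ 2)⁻¹) (Metric.ball 0 1) := by
  have : NeZero d := ⟨by omega⟩
  have : Nontrivial (Euc d) := inferInstance
  rw [integrableOn_fun_norm_addHaar volume (f := fun y : ℝ => (y ^ 2)⁻¹)]
  have : Set.EqOn (fun y : ℝ => y ^ (d - 3)) (fun y : ℝ =>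
      y ^ (Module.finrank ℝ (Euc d) - 1) • (y ^ 2)⁻¹) (Set.Ioo 0 1) := by
    intro y hy
    have hy0 : y ≠ 0 := hy.1.ne'
    simp only [finrank_euclideanSpace, Fintype.card_fin, smul_eq_mul]
    rw [show d - 1 = (d - 3) + 2 by omega, pow_add, mul_inv_cancel_right₀ (by positivity)]
  refine IntegrableOn.congr_fun ?_ this measurableSet_Ioo
  exact (Continuous.integrableOn_Icc (by fun_prop)).mono_set Set.Ioo_subset_Icc_self

theorem IsCutoff.continuous_prod {η τ : Euc d → ℝ} {ε : ℝ} (hη : IsCutoff η τ ε)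
    {f : Euc d × ℝ → ℝ} (hf : ∀ x ≠ 0, ∀ t, ContinuousAt f (x, t)) :
    Continuous (fun y : ℝ × Euc d => η y.2 * f (y.2, y.1)) :=
  continuous_cutoff_mul hη.continuous hη.zero_notMem (π := fun y : ℝ × Euc d => y.2)
    continuous_snd (fun y hy => ContinuousAt.comp (g := f) (hf y.2 hy y.1)
      (f := fun y : ℝ × Euc d => (y.2, y.1)) (by fun_prop))

/-- A space-time density continuous off the spatial origin becomes integrable on bounded time
intervals once multiplied by a cutoff. -/
theorem IsCutoff.integrable_prod {η τ : Euc d → ℝ} {ε : ℝ} (hη : IsCutoff η τ ε)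
    {f : Euc d × ℝ → ℝ} (hf : ∀ x ≠ 0, ∀ t, ContinuousAt f (x, t)) (a b : ℝ) :
    Integrable (Function.uncurry fun (t : ℝ) (x : Euc d) => η x * f (x, t))
      ((volume.restrict (Set.uIoc a b)).prod volume) := by
  have hc := hη.continuous_prod hf
  have h1 : IntegrableOn (fun y : ℝ × Euc d => η y.2 * f (y.2, y.1))
      (Set.uIoc a b ×ˢ tsupport η) (volume.prod volume) :=
    (hc.continuousOn.integrableOn_compact (isCompact_uIcc.prod hη.compact.isCompact)).mono_set
      (Set.prod_mono Set.uIoc_subset_uIcc subset_rfl)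
  have h2 : IntegrableOn (fun y : ℝ × Euc d => η y.2 * f (y.2, y.1))
      (Set.uIoc a b ×ˢ Set.univ) (volume.prod volume) := by
    refine h1.of_forall_sdiff_eq_zero (measurableSet_uIoc.prod .univ) fun y hy => ?_
    have : y.2 ∉ tsupport η := fun h => hy.2 ⟨hy.1.1, h⟩
    simp [image_eq_zero_of_notMem_tsupport this]
  rwa [IntegrableOn, ← Measure.prod_restrict, Measure.restrict_univ] at h2

theorem IsCutoff.integrable_slice {η τ : Euc d → ℝ} {ε : ℝ} (hη : IsCutoff η τ ε)
    {f : Euc d × ℝ → ℝ} (hf : ∀ x ≠ 0, ∀ t, ContinuousAt f (x, t)) (t : ℝ) :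
    Integrable fun x => η x * f (x, t) :=
  (continuous_cutoff_mul hη.continuous hη.zero_notMem continuous_id
    (f := fun x => f (x, t)) (fun x hx => ContinuousAt.comp (g := f) (hf x hx t)
      (f := fun x : Euc d => (x, t)) (by fun_prop))).integrable_of_hasCompactSupport
        hη.compact.mul_right

theorem continuousAt_slice {f : Euc d × ℝ → ℝ} {x : Euc d} {t : ℝ} (hf : ContinuousAt f (x, t)) :
    ContinuousAt (fun y => f (y, t)) x :=
  ContinuousAt.comp (g := f) (f := fun x : Euc d => (x, t)) hf (by fun_prop)

namespace Jet

variable {J : Jet d} {p ζ δ : ℝ}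

variable (J p ζ) in
/-- The energy density. -/
noncomputable def energy (y : Euc d × ℝ) : ℝ :=
  1 / 2 * J.gradSq y + 1 / 2 * J.w y ^ 2 + J.v y ^ 2 * ‖y.1‖⁻¹ / 2
    + ζ * (|J.v y| ^ (p + 1) / (p + 1))

theorem energy_bounds (hp : 1 < p) (hζ : 0 ≤ ζ) (y : Euc d × ℝ) :
    J.gradSq y ≤ 2 * J.energy p ζ y ∧ J.w y ^ 2 ≤ 2 * J.energy p ζ y ∧
    J.v y ^ 2 * ‖y.1‖⁻¹ ≤ 2 * J.energy p ζ y ∧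
    ζ * (|J.v y| ^ (p + 1) / (p + 1)) ≤ J.energy p ζ y ∧
    1 / 2 * J.gradSq y + 1 / 2 * J.w y ^ 2 ≤ J.energy p ζ y := by
  have h1 := J.gradSq_nonneg y
  have h2 := sq_nonneg (J.w y)
  have h3 : 0 ≤ J.v y ^ 2 * ‖y.1‖⁻¹ := by positivity
  have h4 : 0 ≤ ζ * (|J.v y| ^ (p + 1) / (p + 1)) := by
    have : 0 < p + 1 := by linarith
    positivity
  unfold energy
  refine ⟨?_, ?_, ?_, ?_, ?_⟩ <;> linarith

theorem energy_nonneg (hp : 1 < p) (hζ : 0 ≤ ζ) (y : Euc d × ℝ) : 0 ≤ J.energy p ζ y := by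
  have := (J.energy_bounds hp hζ y).2.1
  nlinarith [sq_nonneg (J.w y)]

theorem bulk_nonneg (hd : 4 ≤ d) (hp : 1 < p) (hζ : 0 ≤ ζ) (hδ : 0 < δ) (y : Euc d × ℝ) :
    0 ≤ J.bulk p ζ δ y := by
  have hq := wq_pos hδ y.1
  have hS := J.gradSq_nonneg y
  have h1 : wq δ y.1 ^ 3 * J.radial y ^ 2 ≤ wq δ y.1 * J.gradSq y := by
    calc _ = wq δ y.1 * (wq δ y.1 ^ 2 * J.radial y ^ 2) := by ring
      _ ≤ wq δ y.1 * (wq δ y.1 ^ 2 * (‖y.1‖ ^ 2 * J.gradSq y)) := by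
        gcongr; exact radial_sq_le y
      _ = wq δ y.1 * ((wq δ y.1 ^ 2 * ‖y.1‖ ^ 2) * J.gradSq y) := by ring
      _ ≤ wq δ y.1 * (1 * J.gradSq y) := by gcongr; exact (wq_sq_mul_le hδ y.1).1
      _ = _ := by ring
  have h2 : 0 ≤ 1 / 2 * wq δ y.1 * J.v y ^ 2 * ‖y.1‖⁻¹ := by positivity
  have h3 : 0 ≤ ζ * wb δ y.1 * ((p - 1) / (p + 1) * |J.v y| ^ (p + 1)) := by
    have := wb_nonneg hd hδ y.1
    have : 0 < p - 1 := by linarith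
    have : 0 < p + 1 := by linarith
    positivity
  have h4 : 0 ≤ 1 / 2 * (d * wc δ y.1 - ‖y.1‖ ^ 2 * wc' δ y.1) * J.v y ^ 2 := by
    have := bilaplacian_nonneg hd hδ y.1
    positivity
  unfold bulk
  linarith

theorem sum_mul_flux (y : Euc d × ℝ) : ∑ i, y.1 i * J.flux p ζ δ i y =
    J.radial y * J.mult δ y + ‖y.1‖ ^ 2 * (wq δ y.1 * J.lagr p ζ y)
      + ‖y.1‖ ^ 2 * (1 / 2 * wc δ y.1 * J.v y ^ 2) := by
  rw [EuclideanSpace.real_norm_sq_eq, radial, Finset.sum_mul, Finset.sum_mul, Finset.sum_mul,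
    ← Finset.sum_add_distrib, ← Finset.sum_add_distrib]
  refine Finset.sum_congr rfl fun i _ => ?_
  unfold flux; ring

theorem wq_le_norm_inv {x : Euc d} (hx : x ≠ 0) : wq δ x ≤ ‖x‖⁻¹ := by
  have h0 : 0 < ‖x‖ := norm_pos_iff.2 hx
  refine inv_anti₀ h0 (Real.le_sqrt_of_sq_le ?_)
  nlinarith [sq_nonneg δ]

theorem abs_sum_mul_flux_le (hd : 4 ≤ d) (hp : 1 < p) (hζ : 0 ≤ ζ) (hδ : 0 < δ) {C : ℝ}
    (hC : ∀ x : Euc d, wq δ x ≤ C ∧ wb δ x ≤ C ∧ wc δ x ≤ C * wq δ x)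
    {x : Euc d} (hx : x ≠ 0) (t : ℝ) :
    |∑ i, x i * J.flux p ζ δ i (x, t)| ≤ ‖x‖ ^ 2 * (C * (8 * J.energy p ζ (x, t)
      + J.v (x, t) ^ 2 * (‖x‖ ^ 2)⁻¹)) := by
  obtain ⟨hq, hb, hc⟩ := hC x
  have hq0 := wq_pos hδ x
  have hb0 := wb_nonneg hd hδ x
  have hc0 := wc_nonneg hd hδ x
  have hC0 : 0 ≤ C := hq0.le.trans hq
  have hr : 0 < ‖x‖ := norm_pos_iff.2 hx
  have hqr := wq_le_norm_inv (δ := δ) hx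
  obtain ⟨e1, e2, e3, e4, -⟩ := J.energy_bounds hp hζ (x, t)
  have hS := J.gradSq_nonneg (x, t)
  have hW := J.radial_sq_le (x, t)
  have hN : 0 ≤ ζ * (|J.v (x, t)| ^ (p + 1) / (p + 1)) := by
    have : 0 < p + 1 := by linarith
    positivity
  have hen := J.energy_nonneg hp hζ (x, t)
  have hsum := sum_mul_flux (J := J) (p := p) (ζ := ζ) (δ := δ) (x, t)
  simp only at hsum hW e3
  rw [hsum]
  set s := ‖x‖ ^ 2 with hs
  have hs0 : 0 < s := by positivity
  set e := J.energy p ζ (x, t)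
  set V := J.v (x, t) ^ 2 * s⁻¹
  have hV0 : 0 ≤ V := by positivity
  have hV : J.v (x, t) ^ 2 = s * V := by simp only [V]; field_simp
  have hU0 : 0 ≤ J.v (x, t) ^ 2 * ‖x‖⁻¹ := by positivity
  have t1 : |J.radial (x, t) * J.mult δ (x, t)| ≤ s * (C * (3 * e + V / 2)) := by
    have a1 : |J.radial (x, t) * J.mult δ (x, t)| ≤
        wq δ x * J.radial (x, t) ^ 2 + wb δ x * ((J.radial (x, t) ^ 2 + J.v (x, t) ^ 2) / 2) := by
      unfold mult
      rw [abs_le]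
      constructor
      · nlinarith [mul_nonneg hb0 (sq_nonneg (J.radial (x, t) + J.v (x, t))),
          mul_nonneg hq0.le (sq_nonneg (J.radial (x, t)))]
      · nlinarith [mul_nonneg hb0 (sq_nonneg (J.radial (x, t) - J.v (x, t)))]
    have a2 : J.radial (x, t) ^ 2 ≤ s * (2 * e) := hW.trans (by gcongr)
    calc _ ≤ _ := a1
      _ ≤ C * (s * (2 * e)) + C * ((s * (2 * e) + s * V) / 2) := by
        rw [hV]; gcongr
      _ = _ := by ring
  have t2 : |s * (wq δ x * J.lagr p ζ (x, t))| ≤ s * (C * (4 * e)) := by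
    have a1 : |J.lagr p ζ (x, t)| ≤ 4 * e := by
      unfold lagr
      simp only
      rw [abs_le]; constructor <;> nlinarith [sq_nonneg (J.w (x, t))]
    rw [abs_mul, abs_mul, abs_of_pos hs0, abs_of_pos hq0]
    gcongr
  have t3 : |s * (1 / 2 * wc δ x * J.v (x, t) ^ 2)| ≤ s * (C * e) := by
    rw [abs_of_nonneg (by positivity)]
    have : wc δ x * J.v (x, t) ^ 2 ≤ C * (2 * e) := by
      calc _ ≤ (C * ‖x‖⁻¹) * J.v (x, t) ^ 2 := by
            gcongr; exact hc.trans (by gcongr)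
        _ = C * (J.v (x, t) ^ 2 * ‖x‖⁻¹) := by ring
        _ ≤ _ := by gcongr
    have := mul_le_mul_of_nonneg_left this hs0.le
    linarith
  calc _ ≤ _ := (abs_add_le _ _).trans (add_le_add (abs_add_le _ _) le_rfl)
    _ ≤ s * (C * (3 * e + V / 2)) + s * (C * (4 * e)) + s * (C * e) := by gcongr
    _ ≤ _ := by
      have : 0 ≤ s * (C * V) := by positivity
      linarith

/-- Conserved finite energy, for a continuous jet. -/
structure HasEnergy (J : Jet d) (p ζ E : ℝ) : Prop where
  continuous_v : Continuous J.v
  integrable : ∀ t, Integrable fun x => J.energy p ζ (x, t)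
  integral_eq : ∀ t, ∫ x, J.energy p ζ (x, t) = E

/-- The cutoff error in the Morawetz identity is bounded by the energy and the local Hardy term. -/
theorem HasEnergy.exists_flux_bound {E : ℝ} (hE : J.HasEnergy p ζ E) (hd : 4 ≤ d) (hp : 1 < p)
    (hζ : 0 ≤ ζ) (hδ : 0 < δ) (T : ℝ) : ∃ C : ℝ, ∀ {η τ : Euc d → ℝ} {ε : ℝ}, IsCutoff η τ ε →
      ∀ t ∈ Set.Icc (-T) T, |∫ x, τ x * ∑ i, x i * J.flux p ζ δ i (x, t)| ≤ C * ε := by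
  obtain ⟨C, hC0, hC⟩ := exists_weight_bound hd hδ
  obtain ⟨K, hK⟩ := ((isCompact_closedBall (0 : Euc d) 1).prod
    (isCompact_Icc (a := -T) (b := T))).exists_bound_of_continuousOn hE.continuous_v.continuousOn
  let Λ : ℝ → Euc d → ℝ := fun t x => 10 * J.energy p ζ (x, t)
    + K ^ 2 * (Metric.ball (0 : Euc d) 1).indicator (fun x => (‖x‖ ^ 2)⁻¹) x
  have hΛi : ∀ t, Integrable (Λ t) := fun t => ((hE.integrable t).const_mul _).add
    (((integrableOn_norm_inv_sq hd).integrable_indicator Metric.isOpen_ball.measurableSet).const_mul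
      _)
  refine ⟨C * (10 * E + K ^ 2 * ∫ x, (Metric.ball (0 : Euc d) 1).indicator
    (fun x => (‖x‖ ^ 2)⁻¹) x), fun {η τ ε} hη t ht => ?_⟩
  have hbound : ∀ᵐ x : Euc d, ‖τ x * ∑ i, x i * J.flux p ζ δ i (x, t)‖ ≤ ε * (C * Λ t x) := by
    filter_upwards [ae_ne_zero hd] with x hx
    have hr : 0 < ‖x‖ := norm_pos_iff.2 hx
    have hen := J.energy_nonneg hp hζ (x, t)
    have hΛ : 8 * J.energy p ζ (x, t) + J.v (x, t) ^ 2 * (‖x‖ ^ 2)⁻¹ ≤ Λ t x := by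
      simp only [Λ]
      by_cases h1 : x ∈ Metric.ball (0 : Euc d) 1
      · rw [Set.indicator_of_mem h1]
        have := hK (x, t) ⟨Metric.ball_subset_closedBall h1, ht⟩
        rw [Real.norm_eq_abs] at this
        have : J.v (x, t) ^ 2 ≤ K ^ 2 := sq_le_sq' (abs_le.1 this).1 (abs_le.1 this).2
        have : J.v (x, t) ^ 2 * (‖x‖ ^ 2)⁻¹ ≤ K ^ 2 * (‖x‖ ^ 2)⁻¹ := by gcongr
        linarith
      · rw [Set.indicator_of_notMem h1]
        have h1' : 1 ≤ ‖x‖ := by simpa using h1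
        have h2 : J.v (x, t) ^ 2 * (‖x‖ ^ 2)⁻¹ ≤ J.v (x, t) ^ 2 * ‖x‖⁻¹ := by
          gcongr; nlinarith
        have := (J.energy_bounds hp hζ (x, t)).2.2.1
        simp only at this
        linarith
    rw [norm_mul, Real.norm_eq_abs, Real.norm_eq_abs]
    have hΛ0 : 0 ≤ Λ t x := le_trans (by positivity) hΛ
    calc _ ≤ |τ x| * (‖x‖ ^ 2 * (C * (8 * J.energy p ζ (x, t)
            + J.v (x, t) ^ 2 * (‖x‖ ^ 2)⁻¹))) := by
          gcongr; exact J.abs_sum_mul_flux_le hd hp hζ hδ hC hx t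
      _ ≤ |τ x| * (‖x‖ ^ 2 * (C * Λ t x)) := by gcongr
      _ = |τ x| * ‖x‖ ^ 2 * (C * Λ t x) := by ring
      _ ≤ _ := by gcongr; exact hη.grad_le x
  refine (norm_integral_le_of_norm_le (((hΛi t).const_mul C).const_mul ε) hbound).trans_eq ?_
  rw [integral_const_mul, integral_const_mul, integral_add ((hE.integrable t).const_mul _)
    (((integrableOn_norm_inv_sq hd).integrable_indicator Metric.isOpen_ball.measurableSet).const_mul
      _), integral_const_mul, integral_const_mul, hE.integral_eq]
  ring

theorem IsSolution.integral_bulk_eq (hJ : J.IsSolution p ζ) (hd : 4 ≤ d) (hp : 1 < p)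
    (hδ : 0 < δ) {η τ : Euc d → ℝ} {ε : ℝ} (hη : IsCutoff η τ ε) (t : ℝ) :
    ∫ x, η x * J.bulk p ζ δ (x, t) = - (∫ x, τ x * ∑ i, x i * J.flux p ζ δ i (x, t))
      - ∫ x, η x * J.momDeriv δ (x, t) := by
  have h := hη.integral_mul_div (F := fun i x => J.flux p ζ δ i (x, t))
    (F' := fun i x => J.fluxDeriv p ζ δ i (x, t))
    (fun i x hx => hJ.hasLineDerivAt_flux hp hδ hx t i)
    (fun i x hx => continuousAt_slice (hJ.continuousAt_flux hp hδ hx t i))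
    (fun i x hx => continuousAt_slice (hJ.continuousAt_fluxDeriv hp hδ hx t i))
  rw [← h, ← integral_sub]
  · refine integral_congr_ae ?_
    filter_upwards [ae_ne_zero hd] with x hx
    rw [hJ.sum_fluxDeriv hp hδ hx t]; ring
  · refine (integrable_congr ?_).2 (hη.integrable_slice
      (f := fun y => J.momDeriv δ y + J.bulk p ζ δ y) (fun x hx t =>
        (hJ.continuousAt_momDeriv hδ hx t).add (hJ.continuousAt_bulk hp hδ hx t)) t)
    filter_upwards [ae_ne_zero hd] with x hx
    rw [hJ.sum_fluxDeriv hp hδ hx t]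
  · exact hη.integrable_slice (fun x hx t => hJ.continuousAt_momDeriv hδ hx t) t

end Jet

/-! ### The momentum bound and the regularised Morawetz estimate -/

theorem norm_sq_mul_wq_mul_wc_le {δ : ℝ} (hd : 4 ≤ d) (hδ : 0 < δ) (x : Euc d) :
    ‖x‖ ^ 2 * wq δ x * wc δ x ≤ wb δ x ^ 2 := by
  have hd' : (4 : ℝ) ≤ d := by exact_mod_cast hd
  have h : ‖x‖ ^ 2 * wq δ x ^ 2 = 1 - δ ^ 2 * wq δ x ^ 2 := by rw [← wq_sq hδ x]; ring
  have e : wb δ x ^ 2 - ‖x‖ ^ 2 * wq δ x * wc δ x = wq δ x ^ 2 * (((d : ℝ) - 1) * (d - 3) / 4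
      + (d - 5 / 2) * (δ ^ 2 * wq δ x ^ 2) + 7 / 4 * (δ ^ 2 * wq δ x ^ 2) ^ 2) := by
    have : ‖x‖ ^ 2 * wq δ x * wc δ x = (‖x‖ ^ 2 * wq δ x ^ 2) * wq δ x ^ 2
      * (((d : ℝ) - 1) / 2 + 3 * δ ^ 2 / 2 * wq δ x ^ 2) := by unfold wc; ring
    rw [this, h, wb]; ring
  have h1 : 0 ≤ (d : ℝ) - 1 := by linarith
  have h2 : 0 ≤ (d : ℝ) - 3 := by linarith
  have h3 : 0 ≤ (d : ℝ) - 5 / 2 := by linarith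
  rw [← sub_nonneg, e]
  positivity

namespace Jet

variable {J : Jet d} {p ζ δ E : ℝ}

variable (J δ) in
/-- The field whose divergence completes the square in the momentum bound. -/
noncomputable def hardy (i : Fin d) (y : Euc d × ℝ) : ℝ :=
  y.1 i * wq δ y.1 * wb δ y.1 * J.v y ^ 2

variable (J δ) in
/-- The derivative of `hardy i` in the `i`-th direction. -/
noncomputable def hardyDeriv (i : Fin d) (y : Euc d × ℝ) : ℝ :=
  (wq δ y.1 - y.1 i ^ 2 * wq δ y.1 ^ 3) * wb δ y.1 * J.v y ^ 2
    - y.1 i ^ 2 * (wq δ y.1 * wc δ y.1) * J.v y ^ 2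
    + y.1 i * J.g i y * (2 * wq δ y.1 * wb δ y.1 * J.v y)

theorem IsSolution.hasLineDerivAt_hardy (hJ : J.IsSolution p ζ) (hδ : 0 < δ) {x : Euc d}
    (hx : x ≠ 0) (t : ℝ) (i : Fin d) : HasLineDerivAt ℝ (fun y => J.hardy δ i (y, t))
      (J.hardyDeriv δ i (x, t)) x (basisVec i) := by
  have hq : HasDerivAt (fun s : ℝ => wq δ (x + s • basisVec i)) _ 0 := hasLineDerivAt_wq hδ x i
  have hb : HasDerivAt (fun s : ℝ => wb δ (x + s • basisVec i)) _ 0 := wb_hasLineDerivAt hδ x i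
  have hv : HasDerivAt (fun s : ℝ => J.v (x + s • basisVec i, t)) _ 0 :=
    hJ.hasLineDerivAt_v i x hx t
  have hc : HasDerivAt (fun s : ℝ => (x + s • basisVec i : Euc d) i) _ 0 :=
    hasLineDerivAt_coord x i i
  refine (((hc.mul hq).mul hb).mul (hv.pow 2)).congr_deriv ?_
  simp only [zero_smul, add_zero, hardyDeriv, Pi.mul_apply, if_true, Pi.pow_apply]
  ring

theorem IsSolution.continuousAt_hardyDeriv (hJ : J.IsSolution p ζ) (hδ : 0 < δ) {x : Euc d}
    (hx : x ≠ 0) (t : ℝ) (i : Fin d) : ContinuousAt (J.hardyDeriv δ i) (x, t) := by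
  have h1 := hJ.continuousAt_v x hx t
  have h2 := hJ.continuousAt_g i x hx t
  have h5 := continuousAt_fst_comp (continuous_wq hδ) (x, t)
  have h6 := continuousAt_fst_comp (continuous_wc hδ) (x, t)
  have h7 := continuousAt_fst_comp (continuous_wb hδ) (x, t)
  unfold hardyDeriv
  fun_prop

theorem sq_mult_le (hd : 4 ≤ d) (hδ : 0 < δ) (y : Euc d × ℝ) :
    J.mult δ y ^ 2 ≤ J.gradSq y + ∑ i, J.hardyDeriv δ i y := by
  have hsum : ∑ i, J.hardyDeriv δ i y = 2 * wb δ y.1 ^ 2 * J.v y ^ 2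
      - ‖y.1‖ ^ 2 * wq δ y.1 * wc δ y.1 * J.v y ^ 2
      + J.radial y * (2 * wq δ y.1 * wb δ y.1 * J.v y) := by
    have hdd : ∀ a : ℝ, (d : ℝ) * a = ∑ _i : Fin d, a := fun a => by simp
    have e : 2 * wb δ y.1 ^ 2 = (d * wq δ y.1 - ‖y.1‖ ^ 2 * wq δ y.1 ^ 3) * wb δ y.1 := by
      rw [natCast_mul_wq_sub hδ]; ring
    rw [e, EuclideanSpace.real_norm_sq_eq, radial, hdd]
    simp only [Finset.sum_mul, ← Finset.sum_sub_distrib, ← Finset.sum_add_distrib]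
    refine Finset.sum_congr rfl fun i _ => ?_
    unfold hardyDeriv; ring
  have h1 : wq δ y.1 ^ 2 * J.radial y ^ 2 ≤ J.gradSq y := by
    calc _ ≤ wq δ y.1 ^ 2 * (‖y.1‖ ^ 2 * J.gradSq y) := by gcongr; exact radial_sq_le y
      _ = (wq δ y.1 ^ 2 * ‖y.1‖ ^ 2) * J.gradSq y := by ring
      _ ≤ 1 * J.gradSq y := by
        gcongr
        · exact J.gradSq_nonneg y
        · exact (wq_sq_mul_le hδ y.1).1
      _ = _ := one_mul _
  have h2 := mul_le_mul_of_nonneg_right (norm_sq_mul_wq_mul_wc_le hd hδ y.1) (sq_nonneg (J.v y))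
  rw [hsum, mult]
  nlinarith

/-- The truncated Morawetz momentum is bounded by the energy up to the cutoff error. -/
theorem HasEnergy.exists_mom_bound (hE : J.HasEnergy p ζ E) (hJ : J.IsSolution p ζ) (hd : 4 ≤ d)
    (hp : 1 < p) (hζ : 0 ≤ ζ) (hδ : 0 < δ) : ∃ C : ℝ, ∀ {η τ : Euc d → ℝ} {ε : ℝ},
      IsCutoff η τ ε → ∀ t, |∫ x, η x * (J.w (x, t) * J.mult δ (x, t))| ≤ E + C * ε := by
  obtain ⟨C, hC0, hC⟩ := exists_weight_bound hd hδ
  refine ⟨C * E, fun {η τ ε} hη t => ?_⟩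
  have hYc : ∀ i, ∀ x ≠ 0, ∀ t, ContinuousAt (J.hardyDeriv δ i) (x, t) :=
    fun i x hx t => hJ.continuousAt_hardyDeriv hδ hx t i
  have hdiv := hη.integral_mul_div (F := fun i x => J.hardy δ i (x, t))
    (F' := fun i x => J.hardyDeriv δ i (x, t))
    (fun i x hx => hJ.hasLineDerivAt_hardy hδ hx t i)
    (fun i x hx => continuousAt_slice (by
      have h1 := hJ.continuousAt_v x hx t
      have h5 := continuousAt_fst_comp (continuous_wq hδ) (x, t)
      have h7 := continuousAt_fst_comp (continuous_wb hδ) (x, t)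
      unfold hardy; fun_prop))
    (fun i x hx => continuousAt_slice (hYc i x hx t))
  have hYi : Integrable fun x => η x * ∑ i, J.hardyDeriv δ i (x, t) :=
    hη.integrable_slice (f := fun y => ∑ i, J.hardyDeriv δ i y)
      (fun x hx t => tendsto_finsetSum _ fun i _ => hYc i x hx t) t
  have hpt : ∀ᵐ x : Euc d, ‖η x * (J.w (x, t) * J.mult δ (x, t))‖ ≤
      J.energy p ζ (x, t) + 1 / 2 * (η x * ∑ i, J.hardyDeriv δ i (x, t)) := by
    refine .of_forall fun x => ?_
    have h1 := J.sq_mult_le hd hδ (x, t)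
    have h2 := (J.energy_bounds hp hζ (x, t)).2.2.2.2
    have h3 := J.energy_nonneg hp hζ (x, t)
    have h0 := hη.nonneg x
    have h4 : |J.w (x, t) * J.mult δ (x, t)| ≤
        J.energy p ζ (x, t) + 1 / 2 * ∑ i, J.hardyDeriv δ i (x, t) := by
      rw [abs_le]
      constructor
      · nlinarith [sq_nonneg (J.w (x, t) + J.mult δ (x, t))]
      · nlinarith [sq_nonneg (J.w (x, t) - J.mult δ (x, t))]
    rw [norm_mul, Real.norm_eq_abs, Real.norm_eq_abs, abs_of_nonneg h0]
    nlinarith [mul_le_mul_of_nonneg_left h4 h0, mul_le_mul_of_nonneg_right (hη.le_one x) h3]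
  have herr : |∫ x, τ x * ∑ i, x i * J.hardy δ i (x, t)| ≤ ε * (C * (2 * E)) := by
    have hi := (((hE.integrable t).const_mul 2).const_mul C).const_mul ε
    refine (norm_integral_le_of_norm_le
      (f := fun x => τ x * ∑ i, x i * J.hardy δ i (x, t)) hi (.of_forall fun x => ?_)).trans_eq ?_
    · have hsum : ∑ i, x i * J.hardy δ i (x, t) =
          ‖x‖ ^ 2 * (wb δ x * (wq δ x * J.v (x, t) ^ 2)) := by
        rw [EuclideanSpace.real_norm_sq_eq, Finset.sum_mul]
        refine Finset.sum_congr rfl fun i _ => ?_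
        unfold hardy; ring
      have hb := wb_nonneg hd hδ x
      have hq := wq_pos hδ x
      have hε : 0 ≤ ε := (by positivity : 0 ≤ |τ x| * ‖x‖ ^ 2).trans (hη.grad_le x)
      have h0 : 0 ≤ ‖x‖ ^ 2 * (wb δ x * (wq δ x * J.v (x, t) ^ 2)) := by positivity
      rw [hsum, norm_mul, Real.norm_of_nonneg h0, Real.norm_eq_abs, ← mul_assoc]
      rcases eq_or_ne x 0 with rfl | hx
      · have := J.energy_nonneg hp hζ (0, t)
        simp only [norm_zero]
        rw [zero_pow two_ne_zero, mul_zero, zero_mul]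
        positivity
      · have h1 := (J.energy_bounds hp hζ (x, t)).2.2.1
        have h2 := wq_le_norm_inv (δ := δ) hx
        have h3 : wq δ x * J.v (x, t) ^ 2 ≤ 2 * J.energy p ζ (x, t) := by
          calc _ ≤ ‖x‖⁻¹ * J.v (x, t) ^ 2 := by gcongr
            _ = J.v (x, t) ^ 2 * ‖x‖⁻¹ := mul_comm _ _
            _ ≤ _ := h1
        have hbC := (hC x).2.1
        have hηε := hη.grad_le x
        exact mul_le_mul hηε (mul_le_mul hbC h3 (by positivity) hC0.le) (by positivity) hε
    · simp only [integral_const_mul, hE.integral_eq]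
  refine (norm_integral_le_of_norm_le ((hE.integrable t).add (hYi.const_mul (1 / 2))) hpt).trans ?_
  rw [integral_add' (hE.integrable t) (hYi.const_mul _), integral_const_mul, hE.integral_eq, hdiv]
  have := (abs_le.1 herr).1
  linarith

/-- The truncated, regularised Morawetz estimate on a bounded time interval. -/
theorem HasEnergy.exists_bulk_bound (hE : J.HasEnergy p ζ E) (hJ : J.IsSolution p ζ) (hd : 4 ≤ d)
    (hp : 1 < p) (hζ : 0 ≤ ζ) (hδ : 0 < δ) {T : ℝ} (hT : 0 ≤ T) :
    ∃ C : ℝ, ∀ {η τ : Euc d → ℝ} {ε : ℝ}, IsCutoff η τ ε →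
      ∫ t in (-T)..T, ∫ x, η x * J.bulk p ζ δ (x, t) ≤ 2 * E + C * ε := by
  obtain ⟨C₁, h₁⟩ := hE.exists_flux_bound hd hp hζ hδ T
  obtain ⟨C₂, h₂⟩ := hE.exists_mom_bound hJ hd hp hζ hδ
  refine ⟨2 * T * C₁ + 2 * C₂, fun {η τ ε} hη => ?_⟩
  have hTT : -T ≤ T := by linarith
  have hbulk := hη.integrable_prod (fun x hx t => hJ.continuousAt_bulk hp hδ hx t) (-T) T
  have hmom := hη.integrable_prod (fun x hx t => hJ.continuousAt_momDeriv hδ hx t) (-T) T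
  have hbt : IntervalIntegrable (fun t => ∫ x, η x * J.bulk p ζ δ (x, t)) volume (-T) T :=
    intervalIntegrable_iff.2 hbulk.integral_prod_left
  have hmt : IntervalIntegrable (fun t => ∫ x, η x * J.momDeriv δ (x, t)) volume (-T) T :=
    intervalIntegrable_iff.2 hmom.integral_prod_left
  have hswap : ∫ t in (-T)..T, ∫ x, η x * J.momDeriv δ (x, t) =
      (∫ x, η x * (J.w (x, T) * J.mult δ (x, T)))
        - ∫ x, η x * (J.w (x, -T) * J.mult δ (x, -T)) := by
    rw [intervalIntegral_integral_swap hmom, ← integral_sub]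
    · refine integral_congr_ae ?_
      filter_upwards [ae_ne_zero hd] with x hx
      rw [intervalIntegral.integral_const_mul,
        intervalIntegral.integral_eq_sub_of_hasDerivAt (fun t _ => hJ.hasDerivAt_mom hx t), mul_sub]
      refine Continuous.intervalIntegrable (continuous_iff_continuousAt.2 fun t => ?_) _ _
      exact ContinuousAt.comp (g := J.momDeriv δ) (f := fun t : ℝ => (x, t))
        (hJ.continuousAt_momDeriv hδ hx t) (by fun_prop)
    all_goals
      exact hη.integrable_slice (f := fun y => J.w y * J.mult δ y)
        (fun x hx t => (hJ.continuousAt_w x hx t).mul (hJ.continuousAt_mult hδ hx t)) _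
  have hle : ∫ t in (-T)..T, ((∫ x, η x * J.bulk p ζ δ (x, t))
      + ∫ x, η x * J.momDeriv δ (x, t)) ≤ ∫ _t in (-T)..T, C₁ * ε := by
    refine intervalIntegral.integral_mono_on hTT (hbt.add hmt) (by simp) fun t ht => ?_
    rw [hJ.integral_bulk_eq hd hp hδ hη t]
    have := (abs_le.1 (h₁ hη t ht)).1
    linarith
  rw [intervalIntegral.integral_add hbt hmt, hswap, intervalIntegral.integral_const,
    smul_eq_mul] at hle
  have a := (abs_le.1 (h₂ hη T)).1
  have b := (abs_le.1 (h₂ hη (-T))).2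
  linarith

end Jet

/-! ### Removal of the regularisation and of the cutoffs -/

namespace Jet

variable {J : Jet d} {p ζ E : ℝ}

variable (J p ζ) in
/-- The Morawetz density. -/
noncomputable def morawetz (y : Euc d × ℝ) : ℝ :=
  1 / 2 * (J.gradSq y - J.radial y ^ 2 / ‖y.1‖ ^ 2) / ‖y.1‖
    + ((d : ℝ) - 1) * ((d : ℝ) - 3) / 4 / 2 * J.v y ^ 2 / ‖y.1‖ ^ 3
    + ζ * ((d : ℝ) - 1) * (p - 1) * |J.v y| ^ (p + 1) / (4 * (p + 1) * ‖y.1‖)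
    + J.v y ^ 2 / (4 * ‖y.1‖ ^ 2)

theorem tendsto_bulk (hp : 1 < p) {x : Euc d} (hx : x ≠ 0) (t : ℝ) :
    Tendsto (fun δ => J.bulk p ζ δ (x, t)) (nhds 0) (nhds (2 * J.morawetz p ζ (x, t))) := by
  have hr : 0 < ‖x‖ := norm_pos_iff.2 hx
  have hq : ContinuousAt (fun δ => wq δ x) 0 := by
    unfold wq
    refine ContinuousAt.inv₀ (by fun_prop) ?_
    have : 0 < ‖x‖ ^ 2 + (0 : ℝ) ^ 2 := by positivity
    exact (Real.sqrt_pos.2 this).ne'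
  have hq0 : wq 0 x = ‖x‖⁻¹ := by simp [wq, Real.sqrt_sq]
  have hc : ContinuousAt (fun δ => J.bulk p ζ δ (x, t)) 0 := by
    unfold bulk wb wc wc'
    fun_prop
  have h0 : J.bulk p ζ 0 (x, t) = 2 * J.morawetz p ζ (x, t) := by
    have : p + 1 ≠ 0 := by linarith
    simp only [bulk, wb, wc, wc', hq0, morawetz]
    field_simp
    ring
  exact h0 ▸ hc.tendsto

theorem IsSolution.lintegral_cutoff_bulk_le (hJ : J.IsSolution p ζ) (hd : 4 ≤ d)
    (hp : 1 < p) (hζ : 0 ≤ ζ) {δ : ℝ} (hδ : 0 < δ) {T : ℝ} (hT : 0 ≤ T) {η τ : Euc d → ℝ} {ε A : ℝ}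
    (hη : IsCutoff η τ ε) (hA : ∫ t in (-T)..T, ∫ x, η x * J.bulk p ζ δ (x, t) ≤ A) :
    ∫⁻ t in Set.Ioc (-T) T, ∫⁻ x, ENNReal.ofReal (η x * J.bulk p ζ δ (x, t)) ≤
      ENNReal.ofReal A := by
  have hTT : -T ≤ T := by linarith
  have hpos : ∀ t x, 0 ≤ η x * J.bulk p ζ δ (x, t) := fun t x =>
    mul_nonneg (hη.nonneg x) (J.bulk_nonneg hd hp hζ hδ (x, t))
  have hc : ∀ x ≠ 0, ∀ t, ContinuousAt (J.bulk p ζ δ) (x, t) :=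
    fun x hx t => hJ.continuousAt_bulk hp hδ hx t
  have h1 : ∀ t, ∫⁻ x, ENNReal.ofReal (η x * J.bulk p ζ δ (x, t)) =
      ENNReal.ofReal (∫ x, η x * J.bulk p ζ δ (x, t)) := fun t =>
    (ofReal_integral_eq_lintegral_ofReal (hη.integrable_slice hc t) (.of_forall (hpos t))).symm
  have h2 := (hη.integrable_prod hc (-T) T).integral_prod_left
  rw [Set.uIoc_of_le hTT] at h2
  simp only [h1]
  rw [← ofReal_integral_eq_lintegral_ofReal (f := fun t => ∫ x, η x * J.bulk p ζ δ (x, t)) h2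
      (.of_forall fun t => integral_nonneg (hpos t)),
    ← intervalIntegral.integral_of_le hTT]
  exact ENNReal.ofReal_le_ofReal hA

theorem HasEnergy.lintegral_morawetz_le (hE : J.HasEnergy p ζ E) (hJ : J.IsSolution p ζ)
    (hd : 4 ≤ d) (hp : 1 < p) (hζ : 0 ≤ ζ) :
    ∫⁻ t : ℝ, ∫⁻ x : Euc d, ENNReal.ofReal (2 * J.morawetz p ζ (x, t)) ≤
      ENNReal.ofReal (2 * E) := by
  obtain ⟨K, -, η, τ, hη, hη1⟩ := exists_isCutoff d
  let δ : ℕ → ℝ := fun n => 1 / (n + 1)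
  have hδ : ∀ n, 0 < δ n := fun n => by simp only [δ]; positivity
  have hδ0 : Tendsto δ atTop (nhds 0) := tendsto_one_div_add_atTop_nhds_zero_nat
  choose C hC using fun n : ℕ => hE.exists_bulk_bound hJ hd hp hζ (hδ n) n.cast_nonneg
  have hm : ∀ n, ∃ m, n ≤ m ∧ C n * (K / (m + 1)) ≤ δ n := fun n => by
    have h : Tendsto (fun m : ℕ => C n * (K / (m + 1))) atTop (nhds 0) := by
      convert tendsto_one_div_add_atTop_nhds_zero_nat.const_mul (C n * K) using 2
      · ring
      · simp
    exact ((eventually_ge_atTop n).and (h.eventually (ge_mem_nhds (hδ n)))).exists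
  choose m hmn hmδ using hm
  have hmt : Tendsto m atTop atTop := tendsto_atTop_mono hmn tendsto_id
  let S : ℕ → Set (ℝ × Euc d) := fun n => Set.Ioc (-(n : ℝ)) n ×ˢ Set.univ
  let f : ℕ → ℝ × Euc d → ENNReal := fun n => (S n).indicator fun y =>
    ENNReal.ofReal (η (m n) y.2 * J.bulk p ζ (δ n) (y.2, y.1))
  have hf : ∀ n, Measurable (f n) := fun n =>
    (ENNReal.measurable_ofReal.comp ((hη (m n)).continuous_prod fun x hx t =>
      hJ.continuousAt_bulk hp (hδ n) hx t).measurable).indicator (measurableSet_Ioc.prod .univ)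
  have hlim : ∀ t, ∀ x ≠ 0, Tendsto (fun n => f n (t, x)) atTop
      (nhds (ENNReal.ofReal (2 * J.morawetz p ζ (x, t)))) := fun t x hx => by
    have h1 : Tendsto (fun n => η (m n) x * J.bulk p ζ (δ n) (x, t)) atTop
        (nhds (2 * J.morawetz p ζ (x, t))) := by
      simpa using ((hη1 x hx).comp hmt).mul ((tendsto_bulk hp hx t).comp hδ0)
    refine ((ENNReal.continuous_ofReal.tendsto _).comp h1).congr' ?_
    have h2 : ∀ᶠ n : ℕ in atTop, |t| < n :=
      tendsto_natCast_atTop_atTop.eventually (eventually_gt_atTop |t|)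
    filter_upwards [h2] with n hn
    have hmem : (t, x) ∈ S n := ⟨⟨(abs_lt.1 hn).1, (abs_lt.1 hn).2.le⟩, trivial⟩
    change _ = (S n).indicator _ _
    rw [Set.indicator_of_mem hmem]
    rfl
  have hbound : ∀ n, ∫⁻ t, ∫⁻ x, f n (t, x) ≤ ENNReal.ofReal (2 * E + δ n) := fun n => by
    refine le_trans (le_of_eq ?_) (hJ.lintegral_cutoff_bulk_le hd hp hζ (hδ n) n.cast_nonneg
      (hη (m n)) ((hC n (hη (m n))).trans (add_le_add_right (hmδ n) (2 * E))))
    rw [← lintegral_indicator measurableSet_Ioc]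
    refine lintegral_congr fun t => ?_
    by_cases ht : t ∈ Set.Ioc (-(n : ℝ)) n
    · rw [Set.indicator_of_mem ht]
      exact lintegral_congr fun x => Set.indicator_of_mem (s := S n) ⟨ht, trivial⟩ _
    · rw [Set.indicator_of_notMem ht]
      exact (lintegral_congr fun x => Set.indicator_of_notMem (s := S n) (fun h => ht h.1) _).trans
        lintegral_zero
  calc ∫⁻ t : ℝ, ∫⁻ x : Euc d, ENNReal.ofReal (2 * J.morawetz p ζ (x, t))
      = ∫⁻ t : ℝ, ∫⁻ x : Euc d, liminf (fun n => f n (t, x)) atTop := by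
        refine lintegral_congr fun t => lintegral_congr_ae ?_
        filter_upwards [ae_ne_zero hd] with x hx
        exact (hlim t x hx).liminf_eq.symm
    _ ≤ ∫⁻ t : ℝ, liminf (fun n => ∫⁻ x, f n (t, x)) atTop :=
        lintegral_mono fun t => lintegral_liminf_le fun n => (hf n).comp measurable_prodMk_left
    _ ≤ liminf (fun n => ∫⁻ t, ∫⁻ x, f n (t, x)) atTop :=
        lintegral_liminf_le fun n => (hf n).lintegral_prod_right'
    _ ≤ liminf (fun n => ENNReal.ofReal (2 * E + δ n)) atTop :=
        liminf_le_liminf (.of_forall hbound)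
    _ = ENNReal.ofReal (2 * E) := by
        refine Tendsto.liminf_eq ((ENNReal.continuous_ofReal.tendsto _).comp ?_)
        simpa using hδ0.const_add (2 * E)

end Jet

/-! ### The jet of a classical solution -/

theorem hasDerivAt_spatial_line {F : Type*} [NormedAddCommGroup F] [NormedSpace ℝ F]
    {f : Euc d × ℝ → F} {f' : Euc d × ℝ →L[ℝ] F} {x : Euc d} {t : ℝ} (hf : HasFDerivAt f f' (x, t))
    (a : Euc d) : HasDerivAt (fun s : ℝ => f (x + s • a, t)) (f' (a, 0)) 0 := by
  have h : HasDerivAt (fun s : ℝ => (x + s • a, t)) (a, 0) 0 :=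
    HasDerivAt.prodMk (by simpa using ((hasDerivAt_id (0 : ℝ)).smul_const a).const_add x)
      (hasDerivAt_const _ _)
  exact HasFDerivAt.comp_hasDerivAt (0 : ℝ) (by simpa using hf) h

theorem hasDerivAt_time_line {F : Type*} [NormedAddCommGroup F] [NormedSpace ℝ F]
    {f : Euc d × ℝ → F} {f' : Euc d × ℝ →L[ℝ] F} {x : Euc d} {t : ℝ}
    (hf : HasFDerivAt f f' (x, t)) : HasDerivAt (fun s : ℝ => f (x, s)) (f' (0, 1)) t :=
  HasFDerivAt.comp_hasDerivAt t hf ((hasDerivAt_const _ _).prodMk (hasDerivAt_id t))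

/-- The jet of a function on space-time. -/
noncomputable def jetOf (U : Euc d × ℝ → ℝ) : Jet d where
  v := U
  w y := fderiv ℝ U y (0, 1)
  z y := fderiv ℝ (fderiv ℝ U) y (0, 1) (0, 1)
  g i y := fderiv ℝ U y (basisVec i, 0)
  k i y := fderiv ℝ (fderiv ℝ U) y (basisVec i, 0) (0, 1)
  h i j y := fderiv ℝ (fderiv ℝ U) y (basisVec j, 0) (basisVec i, 0)

section
variable {U : Euc d × ℝ → ℝ} {x : Euc d} {t : ℝ}

theorem hasFDerivAt_fderiv (hU : ContDiffAt ℝ 2 U (x, t)) :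
    HasFDerivAt (fderiv ℝ U) (fderiv ℝ (fderiv ℝ U) (x, t)) (x, t) :=
  ((hU.fderiv_right (m := 1) (by norm_num)).differentiableAt (by norm_num)).hasFDerivAt

theorem hasFDerivAt_spatial (hU : DifferentiableAt ℝ U (x, t)) :
    HasFDerivAt (fun y => U (y, t)) ((fderiv ℝ U (x, t)).comp (.inl ℝ (Euc d) ℝ)) x :=
  HasFDerivAt.comp (g := U) x hU.hasFDerivAt (hasFDerivAt_prodMk_left x t)

theorem iteratedFDeriv_spatial (hU : ContDiffAt ℝ 2 U (x, t)) (a b : Euc d) :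
    iteratedFDeriv ℝ 2 (fun y => U (y, t)) x ![a, b] =
      fderiv ℝ (fderiv ℝ U) (x, t) (a, 0) (b, 0) := by
  have h1 : fderiv ℝ (fun y => U (y, t)) =ᶠ[nhds x]
      fun y => (fderiv ℝ U (y, t)).comp (.inl ℝ (Euc d) ℝ) := by
    have hev : ∀ᶠ q in nhds (x, t), ContDiffAt ℝ 2 U q := hU.eventually (by simp)
    filter_upwards [(by fun_prop : Continuous fun y : Euc d => (y, t)).continuousAt.eventually hev]
      with y hy
    exact (hasFDerivAt_spatial (hy.differentiableAt (by norm_num))).fderiv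
  have h2 : HasFDerivAt (fun y => fderiv ℝ U (y, t)) _ x :=
    HasFDerivAt.comp (g := fderiv ℝ U) x (hasFDerivAt_fderiv hU) (hasFDerivAt_prodMk_left x t)
  have h3 := (h2.clm_comp (hasFDerivAt_const (ContinuousLinearMap.inl ℝ (Euc d) ℝ) x)).fderiv
  rw [iteratedFDeriv_two_apply, h1.fderiv_eq, h3]
  simp

theorem gradient_spatial_apply (hU : DifferentiableAt ℝ U (x, t)) (i : Fin d) :
    gradient (fun y => U (y, t)) x i = (jetOf U).g i (x, t) := by
  have h := inner_gradient_left (𝕜 := ℝ) (f := fun y => U (y, t)) (x := x) (y := basisVec i)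
  rw [EuclideanSpace.inner_single_right, (hasFDerivAt_spatial hU).fderiv] at h
  simpa [jetOf] using h

theorem norm_sq_gradient_spatial (hU : DifferentiableAt ℝ U (x, t)) :
    ‖gradient (fun y => U (y, t)) x‖ ^ 2 = (jetOf U).gradSq (x, t) := by
  rw [EuclideanSpace.real_norm_sq_eq]
  exact Finset.sum_congr rfl fun i _ => by rw [gradient_spatial_apply hU]

theorem rderiv_spatial (hU : DifferentiableAt ℝ U (x, t)) :
    rderiv (fun y => U (y, t)) x = ‖x‖⁻¹ * (jetOf U).radial (x, t) := by
  rw [rderiv, real_inner_smul_left, PiLp.inner_apply]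
  congr 1
  refine Finset.sum_congr rfl fun i _ => ?_
  rw [gradient_spatial_apply hU]
  simp [mul_comm]

theorem norm_sq_angGrad_spatial (hx : x ≠ 0) (hU : DifferentiableAt ℝ U (x, t)) :
    ‖angGrad (fun y => U (y, t)) x‖ ^ 2 =
      (jetOf U).gradSq (x, t) - (jetOf U).radial (x, t) ^ 2 / ‖x‖ ^ 2 := by
  have h1 : @inner ℝ _ _ (gradient (fun y => U (y, t)) x) (‖x‖⁻¹ • x) =
      rderiv (fun y => U (y, t)) x := real_inner_comm _ _
  have h2 : ‖‖x‖⁻¹ • x‖ = 1 := by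
    rw [norm_smul, norm_inv, norm_norm, inv_mul_cancel₀ (norm_ne_zero_iff.2 hx)]
  rw [angGrad, norm_sub_sq_real, real_inner_smul_right, h1, norm_smul, h2,
    norm_sq_gradient_spatial hU, mul_one, Real.norm_eq_abs, sq_abs, rderiv_spatial hU]
  ring

theorem eDen_eq_energy {p ζ : ℝ} {u : Euc d → ℝ → ℝ}
    (hU : DifferentiableAt ℝ (fun q : Euc d × ℝ => u q.1 q.2) (x, t)) :
    eDen p ζ u x t = (jetOf fun q : Euc d × ℝ => u q.1 q.2).energy p ζ (x, t) := by
  have h1 : deriv (u x) t = _ := (hasDerivAt_time_line hU.hasFDerivAt).deriv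
  rw [eDen, norm_sq_gradient_spatial hU, h1, Jet.energy]
  simp only [jetOf]
  ring

theorem Mden_eq_morawetz {p ζ : ℝ} {u : Euc d → ℝ → ℝ} (hx : x ≠ 0)
    (hU : DifferentiableAt ℝ (fun q : Euc d × ℝ => u q.1 q.2) (x, t)) :
    Mden p ζ u x t = (jetOf fun q : Euc d × ℝ => u q.1 q.2).morawetz p ζ (x, t) := by
  rw [Mden, norm_sq_angGrad_spatial hx hU]
  rfl

end

theorem _root_.IsCoulombSolution.contDiffAt {p ζ E : ℝ} {u : Euc d → ℝ → ℝ}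
    (hu : IsCoulombSolution p ζ u E) {x : Euc d} (hx : x ≠ 0) (t : ℝ) :
    ContDiffAt ℝ 2 (fun q : Euc d × ℝ => u q.1 q.2) (x, t) :=
  hu.2.1.contDiffAt ((isOpen_compl_singleton.prod isOpen_univ).mem_nhds ⟨hx, trivial⟩)

theorem _root_.IsCoulombSolution.differentiableAt {p ζ E : ℝ} {u : Euc d → ℝ → ℝ}
    (hu : IsCoulombSolution p ζ u E) {x : Euc d} (hx : x ≠ 0) (t : ℝ) :
    DifferentiableAt ℝ (fun q : Euc d × ℝ => u q.1 q.2) (x, t) :=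
  (hu.contDiffAt hx t).differentiableAt (by norm_num)

theorem _root_.IsCoulombSolution.isSolution {p ζ E : ℝ} {u : Euc d → ℝ → ℝ}
    (hu : IsCoulombSolution p ζ u E) :
    (jetOf fun q : Euc d × ℝ => u q.1 q.2).IsSolution p ζ := by
  set U : Euc d × ℝ → ℝ := fun q => u q.1 q.2 with hUdef
  have hC : ∀ x ≠ 0, ∀ t, ContDiffAt ℝ 2 U (x, t) := fun x hx t => hu.contDiffAt hx t
  have h1 : ∀ x ≠ 0, ∀ t, HasFDerivAt U (fderiv ℝ U (x, t)) (x, t) := fun x hx t =>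
    (hu.differentiableAt hx t).hasFDerivAt
  have h2 : ∀ x ≠ 0, ∀ t, HasFDerivAt (fderiv ℝ U) (fderiv ℝ (fderiv ℝ U) (x, t)) (x, t) :=
    fun x hx t => hasFDerivAt_fderiv (hC x hx t)
  have hc2 : ∀ x ≠ 0, ∀ t, ContinuousAt (fderiv ℝ (fderiv ℝ U)) (x, t) := fun x hx t =>
    (((hC x hx t).fderiv_right (m := 1) (by norm_num)).fderiv_right (m := 0)
      (by norm_num)).continuousAt
  have hsymm : ∀ x ≠ 0, ∀ t, IsSymmSndFDerivAt ℝ U (x, t) := fun x hx t =>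
    (hC x hx t).isSymmSndFDerivAt (by simp)
  have hw : ∀ x ≠ 0, ∀ t, HasDerivAt (fun s => (jetOf U).w (x, s)) ((jetOf U).z (x, t)) t :=
    fun x hx t => by
      simpa using! (hasDerivAt_time_line (h2 x hx t)).clm_apply (hasDerivAt_const t _)
  have hv : ∀ x ≠ 0, ∀ t, HasDerivAt (u x) ((jetOf U).w (x, t)) t :=
    fun x hx t => hasDerivAt_time_line (h1 x hx t)
  constructor
  case continuousAt_v => exact fun x hx t => (h1 x hx t).continuousAt
  case continuousAt_w => exact fun x hx t => (h2 x hx t).continuousAt.clm_apply continuousAt_const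
  case continuousAt_z =>
    exact fun x hx t => ((hc2 x hx t).clm_apply continuousAt_const).clm_apply continuousAt_const
  case continuousAt_g =>
    exact fun i x hx t => (h2 x hx t).continuousAt.clm_apply continuousAt_const
  case continuousAt_k =>
    exact fun i x hx t => ((hc2 x hx t).clm_apply continuousAt_const).clm_apply continuousAt_const
  case continuousAt_h =>
    exact fun i j x hx t => ((hc2 x hx t).clm_apply continuousAt_const).clm_apply continuousAt_const
  case hasLineDerivAt_v => exact fun i x hx t => hasDerivAt_spatial_line (h1 x hx t) _
  case hasLineDerivAt_g =>
    exact fun j i x hx t => by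
      simpa using! (hasDerivAt_spatial_line (h2 x hx t) (basisVec i)).clm_apply
        (hasDerivAt_const (0 : ℝ) ((basisVec j, 0) : Euc d × ℝ))
  case hasLineDerivAt_w =>
    exact fun i x hx t => by
      simpa using! (hasDerivAt_spatial_line (h2 x hx t) (basisVec i)).clm_apply
        (hasDerivAt_const (0 : ℝ) ((0, 1) : Euc d × ℝ))
  case hasDerivAt_v => exact hv
  case hasDerivAt_g =>
    intro i x hx t
    have : (jetOf U).k i (x, t) = fderiv ℝ (fderiv ℝ U) (x, t) (0, 1) (basisVec i, 0) :=
      hsymm x hx t _ _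
    rw [this]
    simpa using! (hasDerivAt_time_line (h2 x hx t)).clm_apply
      (hasDerivAt_const t ((basisVec i, 0) : Euc d × ℝ))
  case hasDerivAt_w => exact hw
  case symm => exact fun i j x hx t => hsymm x hx t _ _
  case equation =>
    intro x hx t
    have e1 : deriv (deriv (u x)) t = (jetOf U).z (x, t) := by
      rw [funext fun s => (hv x hx s).deriv]
      exact (hw x hx t).deriv
    have e2 : lap (fun y => u y t) x = ∑ i, (jetOf U).h i i (x, t) :=
      Finset.sum_congr rfl fun i _ => iteratedFDeriv_spatial (hC x hx t) (basisVec i) (basisVec i)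
    have := hu.2.2.1 x hx t
    rwa [e1, e2] at this

theorem _root_.IsCoulombSolution.hasEnergy {p ζ E : ℝ} {u : Euc d → ℝ → ℝ}
    (hu : IsCoulombSolution p ζ u E) (hd : 4 ≤ d) :
    (jetOf fun q : Euc d × ℝ => u q.1 q.2).HasEnergy p ζ E := by
  have h : ∀ t, (fun x => eDen p ζ u x t) =ᵐ[volume]
      fun x => (jetOf fun q : Euc d × ℝ => u q.1 q.2).energy p ζ (x, t) := fun t => by
    filter_upwards [ae_ne_zero hd] with x hx using eDen_eq_energy (hu.differentiableAt hx t)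
  exact ⟨hu.1, fun t => (integrable_congr (h t)).1 (hu.2.2.2.1 t), fun t =>
    (integral_congr_ae (h t)).symm.trans (hu.2.2.2.2 t)⟩

end CoulombMorawetz

/-- Global Morawetz estimate: for a classical finite-energy
solution of the Coulomb wave equation in dimension `d ≥ 4` (with the stated
range of `p` in the defocusing case `ζ = 1`, and `p = 3` when `ζ = 0`),
`∫∫ M(x,t) dx dt ≤ E`. -/
theorem stmt13 (d : ℕ) (hd : 4 ≤ d) (p ζ : ℝ) (hζ : ζ = 0 ∨ ζ = 1)
    (hζ1 : ζ = 1 →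
      d ≤ 5 ∧ 1 + 4 / ((d : ℝ) - 1) ≤ p ∧ p ≤ 1 + 4 / ((d : ℝ) - 2))
    (hζ0 : ζ = 0 → p = 3)
    (u : EuclideanSpace ℝ (Fin d) → ℝ → ℝ) (E : ℝ)
    (hu : IsCoulombSolution p ζ u E) :
    ∫⁻ t : ℝ, ∫⁻ x : EuclideanSpace ℝ (Fin d),
        ENNReal.ofReal (Mden p ζ u x t)
      ≤ ENNReal.ofReal E := by
  have hd' : (4 : ℝ) ≤ d := by exact_mod_cast hd
  have hp : 1 < p := by
    rcases hζ with h | h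
    · rw [hζ0 h]; norm_num
    · have : 0 < 4 / ((d : ℝ) - 1) := by
        have : 0 < (d : ℝ) - 1 := by linarith
        positivity
      linarith [(hζ1 h).2.1]
  have hζ' : 0 ≤ ζ := by rcases hζ with h | h <;> simp [h]
  have key := (hu.hasEnergy hd).lintegral_morawetz_le hu.isSolution hd hp hζ'
  have hM : ∀ t, ∫⁻ x, ENNReal.ofReal
      (2 * (CoulombMorawetz.jetOf fun q => u q.1 q.2).morawetz p ζ (x, t)) =
      2 * ∫⁻ x, ENNReal.ofReal (Mden p ζ u x t) := fun t => by
    rw [← lintegral_const_mul' _ _ (by simp)]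
    refine lintegral_congr_ae ?_
    filter_upwards [CoulombMorawetz.ae_ne_zero hd] with x hx
    rw [CoulombMorawetz.Mden_eq_morawetz hx (hu.differentiableAt hx t),
      ENNReal.ofReal_mul zero_le_two, ENNReal.ofReal_ofNat]
  simp only [hM] at key
  rw [lintegral_const_mul' _ _ (by simp), ENNReal.ofReal_mul zero_le_two, ENNReal.ofReal_ofNat,
    ENNReal.mul_le_mul_iff_right (by simp) (by simp)] at key
  exact key
end
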